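/- Let A(t), B(t) ∈ ℤ[t] be such that Δ(t) = −16(4A(t)³ + 27B(t)²) is not the zero polynomial and j(t) = −6912·A(t)³/(4A(t)³ + 27B(t)²) is non-constant. Fix ε > 0. Then there is a constant C > 0 (depending only on A, B, ε) such that for all real x ≥ 2 and all T ≥ x^{5/6+ε}, (1/#F(T))·Σ_{τ ∈ F(T), Δ(τ) ≠ 0} Π_{E(τ)}(0, x) ≤ C·x^{2/3}. -/

import Mathlib

/-- The Farey pairs of order `T`: coprime pairs `(α, β)` of positive integers
with `α, β ≤ T`; the pair `(α, β)` represents the Farey fraction `α/β ∈ F(T)`. -/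
noncomputable def fareyPairs (T : ℝ) : Finset (ℕ × ℕ) :=
  (Finset.Icc 1 ⌊T⌋₊ ×ˢ Finset.Icc 1 ⌊T⌋₊).filter fun ab => Nat.Coprime ab.1 ab.2

/-- The Farey fraction `α/β ∈ ℚ` associated to a pair `(α, β)`. -/
def fareyFrac (ab : ℕ × ℕ) : ℚ := (ab.1 : ℚ) / (ab.2 : ℚ)

/-- Evaluation of an integer polynomial at a rational point. -/
def evalQ (A : Polynomial ℤ) (τ : ℚ) : ℚ := Polynomial.eval₂ (Int.castRingHom ℚ) τ A

/-- The discriminant `Δ(τ) = −16(4A(τ)³ + 27B(τ)²)` of the specialized curve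
`E(τ) : Y² = X³ + A(τ)X + B(τ)`. -/
def discQ (A B : Polynomial ℤ) (τ : ℚ) : ℚ :=
  -16 * (4 * evalQ A τ ^ 3 + 27 * evalQ B τ ^ 2)

/-- The reduction of a rational number modulo `p` (for `p` not dividing the
denominator this is the usual reduction). -/
def ratRed (p : ℕ) (q : ℚ) : ZMod p := (q.num : ZMod p) * ((q.den : ZMod p))⁻¹

/-- The curve `E(τ) : Y² = X³ + A(τ)X + B(τ)` has good reduction at `p` (for this
model): `p` divides neither the denominators of `A(τ)`, `B(τ)` nor the
discriminant `Δ(τ)`, i.e. `p ∤ N(τ)`. -/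
def goodRed (A B : Polynomial ℤ) (τ : ℚ) (p : ℕ) : Prop :=
  ¬ (p : ℤ) ∣ (evalQ A τ).den ∧ ¬ (p : ℤ) ∣ (evalQ B τ).den ∧
    ratRed p (discQ A B τ) ≠ 0

/-- The number of affine points `(x, y) ∈ 𝔽_p²` on `y² = x³ + a·x + b`. -/
def affinePoints (p : ℕ) (a b : ZMod p) : ℕ :=
  ((Finset.range p ×ˢ Finset.range p).filter fun xy =>
    (xy.2 : ZMod p) ^ 2 = (xy.1 : ZMod p) ^ 3 + a * (xy.1 : ZMod p) + b).card

/-- The Frobenius trace `a_p(τ) = p + 1 − #E_p(τ)(𝔽_p)` of the reduction mod `p`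
of the curve `E(τ) : Y² = X³ + A(τ)X + B(τ)` (the projective point count is the
affine count plus one, for the point at infinity). -/
def apFrob (A B : Polynomial ℤ) (τ : ℚ) (p : ℕ) : ℤ :=
  (p : ℤ) - affinePoints p (ratRed p (evalQ A τ)) (ratRed p (evalQ B τ))

open Classical in
/-- `Π_{E(τ)}(a, x)`: the number of primes `p ≤ x` of good reduction for `E(τ)`
with `a_p(τ) = a`. -/
noncomputable def PiTrace (A B : Polynomial ℤ) (τ : ℚ) (a : ℤ) (x : ℝ) : ℕ :=
  ((Finset.range (⌊x⌋₊ + 1)).filter fun p =>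
    p.Prime ∧ goodRed A B τ p ∧ apFrob A B τ p = a).card

/-- The `j`-invariant `j(t) = −6912·A(t)³/(4A(t)³ + 27B(t)²)` is a non-constant
rational function: for no constant `c ∈ ℚ` does `−6912·A(t)³ = c·(4A(t)³ + 27B(t)²)`
hold identically. -/
def jNonconstant (A B : Polynomial ℤ) : Prop :=
  ∀ c : ℚ, (-6912 : Polynomial ℚ) * (A.map (Int.castRingHom ℚ)) ^ 3 ≠
    Polynomial.C c *
      (4 * (A.map (Int.castRingHom ℚ)) ^ 3 + 27 * (B.map (Int.castRingHom ℚ)) ^ 2)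

namespace LangTrotter

open Polynomial

section Bivariate

open scoped Polynomial.Bivariate

variable {k : Type*} [Field k]

/-- The degree of a bivariate polynomial in the inner variable. -/
noncomputable def innerDegree (P : k[X][Y]) : ℕ := (Bivariate.swap P).natDegree

lemma coeff_coeff_swap (P : k[X][Y]) (i j : ℕ) :
    ((Bivariate.swap P).coeff j).coeff i = (P.coeff i).coeff j := by
  induction P using Polynomial.induction_on' with
  | add p q hp hq => simp [hp, hq]
  | monomial n f =>
    induction f using Polynomial.induction_on' with
    | add p q hp hq => simp only [map_add, coeff_add, hp, hq]
    | monomial m r =>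
      rw [Bivariate.swap_monomial_monomial]
      simp only [coeff_monomial]
      split_ifs <;> simp_all [coeff_monomial]

lemma natDegree_coeff_le_innerDegree (P : k[X][Y]) (i : ℕ) :
    (P.coeff i).natDegree ≤ innerDegree P := by
  rw [natDegree_le_iff_coeff_eq_zero]
  intro N hN
  rw [← coeff_coeff_swap, coeff_eq_zero_of_natDegree_lt hN, coeff_zero]

lemma innerDegree_le (P : k[X][Y]) (A : ℕ) (h : ∀ i, (P.coeff i).natDegree ≤ A) :
    innerDegree P ≤ A := by
  rw [innerDegree, natDegree_le_iff_coeff_eq_zero]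
  intro N hN
  ext i
  rw [coeff_coeff_swap, coeff_eq_zero_of_natDegree_lt ((h i).trans_lt hN), coeff_zero]

lemma innerDegree_mul {P Q : k[X][Y]} (hP : P ≠ 0) (hQ : Q ≠ 0) :
    innerDegree (P * Q) = innerDegree P + innerDegree Q := by
  rw [innerDegree, map_mul, natDegree_mul]
  · rfl
  · simpa using hP
  · simpa using hQ

lemma natDegree_resultant_le (P Q : k[X][Y]) :
    (P.resultant Q).natDegree ≤
      innerDegree P * Q.natDegree + innerDegree Q * P.natDegree := by
  rw [resultant, Matrix.det_apply]
  refine natDegree_sum_le_of_forall_le _ _ fun σ _ => ?_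
  refine (natDegree_smul_le _ _).trans ?_
  refine (natDegree_prod_le _ _).trans ?_
  rw [Fin.sum_univ_add, add_comm]
  refine add_le_add ?_ ?_
  · refine (Finset.sum_le_card_nsmul _ _ (innerDegree P) fun i _ => ?_).trans ?_
    · simp only [sylvester, Matrix.of_apply, Fin.addCases_right]
      split_ifs
      · exact natDegree_coeff_le_innerDegree _ _
      · simp
    · simp [mul_comm]
  · refine (Finset.sum_le_card_nsmul _ _ (innerDegree Q) fun i _ => ?_).trans ?_
    · simp only [sylvester, Matrix.of_apply, Fin.addCases_left]
      split_ifs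
      · exact natDegree_coeff_le_innerDegree _ _
      · simp
    · simp [mul_comm]

lemma resultant_ne_zero_of_irreducible {P Q : k[X][Y]} (hP : Irreducible P)
    (hd : P.natDegree ≠ 0) (hPQ : ¬ P ∣ Q) : P.resultant Q ≠ 0 := by
  intro h0
  have hprim : P.IsPrimitive := hP.isPrimitive hd
  have hirr : Irreducible (P.map (algebraMap k[X] (FractionRing k[X]))) :=
    (hprim.irreducible_iff_irreducible_map_fraction_map).1 hP
  have hinj : Function.Injective (algebraMap k[X] (FractionRing k[X])) :=
    IsFractionRing.injective _ _
  have h1 := resultant_map_map P Q P.natDegree Q.natDegree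
    (algebraMap k[X] (FractionRing k[X]))
  rw [h0, map_zero] at h1
  have h2 : (P.map (algebraMap k[X] (FractionRing k[X]))).resultant
      (Q.map (algebraMap k[X] (FractionRing k[X]))) = 0 := by
    rw [natDegree_map_eq_of_injective hinj, natDegree_map_eq_of_injective hinj]
    exact h1
  rw [resultant_eq_zero_iff] at h2
  have h3 := (EuclideanDomain.dvd_or_coprime _ _ hirr).resolve_right h2.2
  obtain ⟨_⟩ : Nonempty (NormalizedGCDMonoid k[X]) := inferInstance
  exact hPQ ((IsPrimitive.dvd_iff_fraction_map_dvd_fraction_map (FractionRing k[X]) hprim).2 h3)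

/-- Specialisation of the outer variable to a power series in the inner variable. -/
noncomputable def ev (u : PowerSeries k) : k[X][Y] →+* PowerSeries k :=
  eval₂RingHom coeToPowerSeries.ringHom u

lemma ev_C (u : PowerSeries k) (f : k[X]) : ev u (C f) = (f : PowerSeries k) := by
  simp [ev]

lemma ev_X (u : PowerSeries k) : ev u (X : k[X][Y]) = u := by
  simp [ev]

lemma le_natDegree_of_X_pow_dvd {f : k[X]} (hf : f ≠ 0) {n : ℕ}
    (h : (PowerSeries.X : PowerSeries k) ^ n ∣ (f : PowerSeries k)) : n ≤ f.natDegree := by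
  by_contra! hlt
  rw [PowerSeries.X_pow_dvd_iff] at h
  have := h f.natDegree hlt
  rw [coeff_coe] at this
  exact hf (leadingCoeff_eq_zero.1 this)

lemma le_of_X_pow_dvd_ev {u : PowerSeries k} {P Q : k[X][Y]} (hP : Irreducible P)
    (hd : P.natDegree ≠ 0) (hPQ : ¬ P ∣ Q) {n : ℕ}
    (h₁ : PowerSeries.X ^ n ∣ ev u P) (h₂ : PowerSeries.X ^ n ∣ ev u Q) :
    n ≤ innerDegree P * Q.natDegree + innerDegree Q * P.natDegree := by
  refine le_trans ?_ (natDegree_resultant_le P Q)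
  apply le_natDegree_of_X_pow_dvd (resultant_ne_zero_of_irreducible hP hd hPQ)
  obtain ⟨p, q, -, -, e⟩ := exists_mul_add_mul_eq_C_resultant P Q le_rfl le_rfl (Or.inl hd)
  rw [← ev_C u, ← e, map_add, map_mul, map_mul]
  exact dvd_add (h₁.mul_right _) (h₂.mul_right _)

end Bivariate

section Riccati

open scoped Polynomial.Bivariate

variable {k : Type*} [Field k]

/-- The derivative of a bivariate polynomial in the inner variable. -/
noncomputable def innerDeriv (P : k[X][Y]) : k[X][Y] :=
  Bivariate.swap (derivative (Bivariate.swap P))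

lemma innerDeriv_add (P Q : k[X][Y]) : innerDeriv (P + Q) = innerDeriv P + innerDeriv Q := by
  simp [innerDeriv]

lemma coeff_innerDeriv (P : k[X][Y]) (i : ℕ) :
    (innerDeriv P).coeff i = derivative (P.coeff i) := by
  ext j
  rw [innerDeriv, coeff_coeff_swap, coeff_derivative, coeff_derivative, ← coeff_coeff_swap P,
    show ((j : k[X]) + 1) = C ((j : k) + 1) by simp, coeff_mul_C]

/-- The derivation of `k[s][U]` extending `s(1-s) d/ds` for which `U` satisfies the Riccati
equation of the hypergeometric equation with parameters `a + b = α`, `ab = γ` and `c = 1`. -/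
noncomputable def riccatiD (α γ : k) (P : k[X][Y]) : k[X][Y] :=
  C (X * (1 - X)) * innerDeriv P +
    (C (X * C α) * Y + C (X * C γ) - C (1 - X) * Y ^ 2) * derivative P

lemma coeff_zero_riccatiD (α γ : k) (P : k[X][Y]) :
    (riccatiD α γ P).coeff 0 =
      X * (1 - X) * derivative (P.coeff 0) + X * C γ * P.coeff 1 := by
  simp only [riccatiD, sub_mul, add_mul, coeff_add, coeff_sub, mul_assoc, coeff_C_mul,
    coeff_innerDeriv, coeff_X_mul_zero, coeff_X_pow_mul', coeff_derivative]
  simp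

lemma coeff_succ_riccatiD (α γ : k) (P : k[X][Y]) (j : ℕ) :
    (riccatiD α γ P).coeff (j + 1) =
      X * (1 - X) * derivative (P.coeff (j + 1)) + X * C α * (((j + 1 : ℕ) : k[X]) * P.coeff (j + 1))
        + X * C γ * (((j + 2 : ℕ) : k[X]) * P.coeff (j + 2)) - (1 - X) * ((j : k[X]) * P.coeff j) := by
  simp only [riccatiD, sub_mul, add_mul, coeff_add, coeff_sub, mul_assoc, coeff_C_mul,
    coeff_innerDeriv, coeff_X_mul, coeff_X_pow_mul', coeff_derivative]
  rcases j with _ | j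
  · simp; ring
  · simp; ring

lemma riccatiD_add (α γ : k) (P Q : k[X][Y]) :
    riccatiD α γ (P + Q) = riccatiD α γ P + riccatiD α γ Q := by
  simp only [riccatiD, innerDeriv_add, derivative_add]; ring

lemma derivative_riccatiD (α γ : k) (P : k[X][Y]) :
    derivative (riccatiD α γ P) = riccatiD α γ (derivative P) +
      (C (X * C α) - 2 * C (1 - X) * Y) * derivative P := by
  have h : derivative (innerDeriv P) = innerDeriv (derivative P) := by
    ext1 i
    simp only [coeff_innerDeriv, coeff_derivative]
    rw [show ((i : k[X]) + 1) = C ((i : k) + 1) by simp, mul_comm, mul_comm _ (C _),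
      derivative_C_mul]
  simp only [riccatiD, derivative_add, derivative_mul, derivative_C, h, derivative_sub,
    derivative_X, derivative_X_pow]
  have h2 : (C (2 : k[X]) : k[X][Y]) = 2 := map_ofNat C 2
  simp [h2]
  ring

lemma innerDegree_riccatiD_le (α γ : k) (P : k[X][Y]) :
    innerDegree (riccatiD α γ P) ≤ innerDegree P + 1 := by
  set A := innerDegree P with hA
  have hc : ∀ i (n : ℕ), ((n : k[X]) * P.coeff i).natDegree ≤ A := fun i n => by
    rw [show (n : k[X]) = C (n : k) by simp]
    exact (natDegree_C_mul_le _ _).trans (natDegree_coeff_le_innerDegree P i)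
  have hX : ∀ (c : k), (X * C c).natDegree ≤ 1 := fun c => by
    rw [mul_comm]
    exact (natDegree_C_mul_le _ _).trans natDegree_X_le
  have h1 : (1 - X : k[X]).natDegree ≤ 1 :=
    (natDegree_sub_le _ _).trans (by simp)
  have hD : ∀ i, (X * (1 - X) * derivative (P.coeff i)).natDegree ≤ A + 1 := fun i => by
    rcases Nat.eq_zero_or_pos (P.coeff i).natDegree with h | h
    · rw [natDegree_eq_zero.1 h |>.choose_spec.symm]; simp
    · have h2 := natDegree_derivative_lt h.ne'
      have h3 := natDegree_coeff_le_innerDegree P i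
      have h4 : (X * (1 - X) : k[X]).natDegree ≤ 1 + 1 :=
        natDegree_mul_le_of_le (by simp) h1
      exact (natDegree_mul_le_of_le h4 (Nat.le_sub_one_of_lt h2)).trans (by omega)
  have hm : ∀ (c : k) i (n : ℕ), (X * C c * ((n : k[X]) * P.coeff i)).natDegree ≤ A + 1 :=
    fun c i n => (natDegree_mul_le_of_le (hX c) (hc i n)).trans (by omega)
  refine innerDegree_le _ _ fun i => ?_
  rcases i with _ | j
  · rw [coeff_zero_riccatiD]
    refine natDegree_add_le_of_degree_le (hD 0) ?_
    simpa using hm γ 1 1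
  · rw [coeff_succ_riccatiD]
    refine (natDegree_sub_le _ _).trans (max_le ?_ ?_)
    · exact natDegree_add_le_of_degree_le
        (natDegree_add_le_of_degree_le (hD _) (hm _ _ _)) (hm _ _ _)
    · exact (natDegree_mul_le_of_le h1 (hc _ _)).trans (by omega)

lemma natDegree_riccatiD_le (α γ : k) (P : k[X][Y]) :
    (riccatiD α γ P).natDegree ≤ P.natDegree + 1 := by
  rw [natDegree_le_iff_coeff_eq_zero]
  intro N hN
  obtain ⟨j, rfl⟩ : ∃ j, N = j + 1 := ⟨N - 1, by omega⟩
  rw [coeff_succ_riccatiD, coeff_eq_zero_of_natDegree_lt (by omega : P.natDegree < j + 1),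
    coeff_eq_zero_of_natDegree_lt (by omega : P.natDegree < j + 2),
    coeff_eq_zero_of_natDegree_lt (by omega : P.natDegree < j)]
  simp

open PowerSeries in
lemma ev_riccatiD {α γ : k} {u : PowerSeries k}
    (hu : PowerSeries.X * (1 - PowerSeries.X) * derivative k u =
      PowerSeries.X * (PowerSeries.C α * u + PowerSeries.C γ) - (1 - PowerSeries.X) * u ^ 2)
    (P : k[X][Y]) :
    ev u (riccatiD α γ P) =
      PowerSeries.X * (1 - PowerSeries.X) * derivative k (ev u P) := by
  induction P using Polynomial.induction_on' with
  | add p q hp hq => rw [riccatiD_add, map_add, map_add, hp, hq, map_add]; ring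
  | monomial n f =>
    have h1 : innerDeriv (Polynomial.monomial n f) =
        Polynomial.monomial n (Polynomial.derivative f) := by
      ext1 i
      rw [coeff_innerDeriv, Polynomial.coeff_monomial, Polynomial.coeff_monomial]
      split_ifs <;> simp
    rw [riccatiD, h1, Polynomial.derivative_monomial]
    simp only [← Polynomial.C_mul_X_pow_eq_monomial, map_add, map_mul, map_sub, ev_C, ev_X,
      map_pow, Derivation.leibniz, Derivation.leibniz_pow, PowerSeries.derivative_coe,
      smul_eq_mul, map_one, Polynomial.coe_X, Polynomial.coe_C, map_natCast]
    simp only [nsmul_eq_mul]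
    linear_combination (-1 : PowerSeries k) * (f : PowerSeries k) * (n : PowerSeries k) * u ^ (n - 1) * hu

end Riccati

section ZeroEstimate

open scoped Polynomial.Bivariate

variable {k : Type*} [Field k]

lemma X_pow_dvd_or_of_dvd_mul {f g : PowerSeries k} {m n : ℕ}
    (h : PowerSeries.X ^ (m + n + 1) ∣ f * g) :
    PowerSeries.X ^ (m + 1) ∣ f ∨ PowerSeries.X ^ (n + 1) ∣ g := by
  rw [pow_dvd_iff_le_emultiplicity, emultiplicity_mul PowerSeries.X_prime] at h
  rw [pow_dvd_iff_le_emultiplicity, pow_dvd_iff_le_emultiplicity]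
  by_contra! hc
  obtain ⟨h1, h2⟩ := hc
  lift emultiplicity PowerSeries.X f to ℕ using h1.ne_top with a
  lift emultiplicity PowerSeries.X g to ℕ using h2.ne_top with b
  norm_cast at *
  omega

lemma exists_irreducible_factor_of_X_pow_dvd (u : PowerSeries k) (A d : ℕ) (P : k[X][Y]) :
    P ≠ 0 → PowerSeries.X ^ (innerDegree P * d + P.natDegree * A + 1) ∣ ev u P →
    ∃ Q, Irreducible Q ∧ Q ∣ P ∧
      PowerSeries.X ^ (innerDegree Q * d + Q.natDegree * A + 1) ∣ ev u Q := by
  induction P using WfDvdMonoid.induction_on_irreducible with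
  | zero => exact fun h => absurd rfl h
  | unit P hP =>
    intro _ h
    exfalso
    have h1 : IsUnit (ev u P) := hP.map _
    exact PowerSeries.X_prime.not_isUnit
      (isUnit_of_dvd_unit (Dvd.dvd.trans (dvd_pow_self _ (by omega)) h) h1)
  | mul P Q hP hQ ih =>
    intro _ h
    rw [innerDegree_mul hQ.ne_zero hP, natDegree_mul hQ.ne_zero hP, map_mul] at h
    have h' := X_pow_dvd_or_of_dvd_mul (m := innerDegree Q * d + Q.natDegree * A)
      (n := innerDegree P * d + P.natDegree * A) (by convert h using 2; ring)
    rcases h' with h' | h'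
    · exact ⟨Q, hQ, dvd_mul_right _ _, h'⟩
    · obtain ⟨R, hR, hRP, hR'⟩ := ih hP h'
      exact ⟨R, hR, hRP.mul_left _, hR'⟩

lemma innerDegree_le_of_dvd {P Q : k[X][Y]} (h : Q ∣ P) (hP : P ≠ 0) :
    innerDegree Q ≤ innerDegree P := by
  obtain ⟨R, rfl⟩ := h
  rw [innerDegree_mul (left_ne_zero_of_mul hP) (right_ne_zero_of_mul hP)]
  exact Nat.le_add_right _ _

/-- The Riccati equation satisfied by `s (dg/ds) / g` for a solution `g` of the hypergeometric
equation with parameters `a + b = α`, `ab = γ`, `c = 1`. -/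
def IsRiccati (α γ : k) (u : PowerSeries k) : Prop :=
  PowerSeries.X * (1 - PowerSeries.X) * PowerSeries.derivative k u =
    PowerSeries.X * (PowerSeries.C α * u + PowerSeries.C γ) - (1 - PowerSeries.X) * u ^ 2

lemma X_pow_dvd_X_mul_derivative {v : PowerSeries k} {n : ℕ} (h : PowerSeries.X ^ n ∣ v) :
    PowerSeries.X ^ n ∣
      PowerSeries.X * (1 - PowerSeries.X) * PowerSeries.derivative k v := by
  rw [mul_right_comm]
  refine Dvd.dvd.mul_right ?_ _
  rw [PowerSeries.X_pow_dvd_iff] at h ⊢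
  intro m hm
  rcases m with _ | m
  · simp
  · rw [PowerSeries.coeff_succ_X_mul, PowerSeries.coeff_derivative, h _ hm, zero_mul]

lemma exists_invariant_factor {α γ : k} {u : PowerSeries k} (hu : IsRiccati α γ u)
    {A d : ℕ} {P : k[X][Y]} (hP : P ≠ 0) (hA : innerDegree P ≤ A) (hd : P.natDegree ≤ d)
    {n : ℕ} (hn : 2 * (A + 1) * (d + 1) ≤ n) (h : PowerSeries.X ^ n ∣ ev u P) :
    ∃ Q, Irreducible Q ∧ Q.natDegree ≠ 0 ∧ innerDegree Q ≤ A ∧ Q.natDegree ≤ d ∧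
      Q ∣ riccatiD α γ Q ∧ PowerSeries.X ∣ ev u Q := by
  obtain ⟨Q, hQ, hQP, hQu⟩ := exists_irreducible_factor_of_X_pow_dvd u (A + 1) (d + 1) P hP
    ((pow_dvd_pow _ (by nlinarith)).trans h)
  have hQA := (innerDegree_le_of_dvd hQP hP).trans hA
  have hQd := (natDegree_le_of_dvd hQP hP).trans hd
  have h0 : Q.natDegree ≠ 0 := by
    intro h0
    obtain ⟨f, hf⟩ := natDegree_eq_zero.1 h0
    have hf0 : f ≠ 0 := by rintro rfl; exact hQ.ne_zero (by simp [← hf])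
    rw [← hf, ev_C, hf, h0] at hQu
    have h1 := le_natDegree_of_X_pow_dvd hf0 hQu
    have h2 := natDegree_coeff_le_innerDegree Q 0
    rw [← hf, coeff_C_zero, hf] at h2
    nlinarith
  refine ⟨Q, hQ, h0, hQA, hQd, ?_, (dvd_pow_self _ (by omega)).trans hQu⟩
  by_contra hnd
  have h1 := le_of_X_pow_dvd_ev hQ h0 hnd hQu (by
    rw [ev_riccatiD hu]
    exact X_pow_dvd_X_mul_derivative hQu)
  have h2 := innerDegree_riccatiD_le α γ Q
  have h3 := natDegree_riccatiD_le α γ Q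
  have h4 : innerDegree Q * (riccatiD α γ Q).natDegree ≤ innerDegree Q * (d + 1) :=
    Nat.mul_le_mul_left _ (by omega)
  have h5 : innerDegree (riccatiD α γ Q) * Q.natDegree ≤ Q.natDegree * (A + 1) := by
    rw [mul_comm]
    exact Nat.mul_le_mul_left _ (by omega)
  omega

lemma X_pow_dvd_of_derivative_eq {p : ℕ} [CharP k p] {v κ t : PowerSeries k}
    (hκ : PowerSeries.X ∣ κ) (hv : PowerSeries.X ∣ v)
    (h : PowerSeries.X * (1 - PowerSeries.X) * PowerSeries.derivative k v = κ * v + t)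
    (ht : PowerSeries.X ^ p ∣ t) : PowerSeries.X ^ p ∣ v := by
  suffices H : ∀ n, n ≤ p → PowerSeries.X ^ n ∣ v from H p le_rfl
  intro n hn
  induction n with
  | zero => simp
  | succ n ih =>
    rcases Nat.eq_zero_or_pos n with rfl | hn0
    · simpa using hv
    have hvn := ih (by omega)
    rw [PowerSeries.X_pow_dvd_iff] at hvn ht ⊢
    intro m hm
    rcases (Nat.lt_succ_iff.1 hm).lt_or_eq with hm | rfl
    · exact hvn m hm
    obtain ⟨l, hl⟩ := hκ
    obtain ⟨m, rfl⟩ : ∃ j, m = j + 1 := ⟨m - 1, by omega⟩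
    have h1 := congrArg (PowerSeries.coeff (m + 1)) h
    rw [hl, mul_assoc, mul_assoc, map_add, PowerSeries.coeff_succ_X_mul,
      PowerSeries.coeff_succ_X_mul, ht _ (by omega), sub_mul, one_mul, map_sub,
      PowerSeries.coeff_derivative, add_zero] at h1
    have h2 : PowerSeries.coeff m (l * v) = 0 := by
      rw [PowerSeries.coeff_mul]
      refine Finset.sum_eq_zero fun x hx => ?_
      rw [hvn x.2 (by have := Finset.HasAntidiagonal.mem_antidiagonal.1 hx; omega), mul_zero]
    have h3 : PowerSeries.coeff m (PowerSeries.X * PowerSeries.derivative k v) = 0 := by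
      rcases m with _ | m
      · simp
      · rw [PowerSeries.coeff_succ_X_mul, PowerSeries.coeff_derivative, hvn _ (by omega),
          zero_mul]
    rw [h2, h3, sub_zero] at h1
    refine (mul_eq_zero.1 h1).resolve_right ?_
    have h4 := (CharP.cast_eq_zero_iff k p (m + 1)).not.2
      (fun hd => by have := Nat.le_of_dvd (by omega) hd; omega)
    exact_mod_cast h4

lemma coeff_succ_mul_linear (Q : k[X][Y]) (a b : k[X]) (j : ℕ) :
    (Q * (C a + C b * Y)).coeff (j + 1) = Q.coeff (j + 1) * a + Q.coeff j * b := by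
  rw [mul_add, coeff_add, coeff_mul_C, mul_comm (C b), ← mul_assoc, coeff_mul_C, coeff_mul_X]

lemma coeff_zero_mul_linear (Q : k[X][Y]) (a b : k[X]) :
    (Q * (C a + C b * Y)).coeff 0 = Q.coeff 0 * a := by
  simp [mul_coeff_zero]

lemma exists_cofactor {α γ : k} {Q : k[X][Y]} (hQ : Q ≠ 0) (hdvd : Q ∣ riccatiD α γ Q) :
    ∃ c : k[X], c.natDegree ≤ 1 ∧
      riccatiD α γ Q = Q * (C c + C (-((Q.natDegree : k[X]) * (1 - X))) * Y) := by
  obtain ⟨c, hc⟩ := hdvd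
  have hdeg : c.natDegree ≤ 1 ∧ (c.coeff 0).natDegree ≤ 1 := by
    by_cases hc0 : c = 0
    · simp [hc0]
    have h1 := natDegree_riccatiD_le α γ Q
    rw [hc, natDegree_mul hQ hc0] at h1
    have h2 := innerDegree_riccatiD_le α γ Q
    rw [hc, innerDegree_mul hQ hc0] at h2
    have h3 := natDegree_coeff_le_innerDegree c 0
    exact ⟨by omega, by omega⟩
  have hc' : c = C (c.coeff 0) + C (c.coeff 1) * Y := by
    conv_lhs => rw [eq_X_add_C_of_natDegree_le_one hdeg.1]
    rw [add_comm]
  refine ⟨c.coeff 0, hdeg.2, ?_⟩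
  suffices h : c.coeff 1 = -((Q.natDegree : k[X]) * (1 - X)) by
    rw [← h, ← hc', hc]
  have h1 := congrArg (fun P : k[X][Y] => P.coeff (Q.natDegree + 1)) hc
  rw [hc', coeff_succ_mul_linear, coeff_succ_riccatiD,
    coeff_eq_zero_of_natDegree_lt (Nat.lt_succ_self Q.natDegree),
    coeff_eq_zero_of_natDegree_lt (by omega : Q.natDegree < Q.natDegree + 2)] at h1
  have h2 : Q.coeff Q.natDegree ≠ 0 := leadingCoeff_ne_zero.2 hQ
  apply mul_left_cancel₀ h2
  simp only [derivative_zero, mul_zero, zero_mul, zero_add, zero_sub] at h1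
  rw [← h1]
  ring

lemma exists_eval_coeff_ne_zero {Q : k[X][Y]} (hQ : Irreducible Q) (hd : Q.natDegree ≠ 0)
    (r : k) : ∃ j, (Q.coeff j).eval r ≠ 0 := by
  by_contra! hall
  have hX : C (X - C r) ∣ Q := by
    rw [C_dvd_iff_dvd_coeff]
    exact fun i => dvd_iff_isRoot.2 (hall i)
  obtain ⟨R, hR⟩ := hX
  rcases hQ.isUnit_or_isUnit hR with h | h
  · exact not_isUnit_X_sub_C r (isUnit_C.1 h)
  · apply hd
    rw [hR, natDegree_C_mul (X_sub_C_ne_zero r)]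
    exact natDegree_eq_zero_of_isUnit h

/-- An invariant polynomial specialises at `s = 0` to a multiple of a power of `U`, and its
cofactor vanishes at the origin. -/
lemma coeff_eval_zero_of_invariant {p : ℕ} [CharP k p] {α γ : k}
    {Q : k[X][Y]} {c : k[X]} (hQ : Irreducible Q) (hd : Q.natDegree ≠ 0) (hdp : Q.natDegree < p)
    (hc : riccatiD α γ Q = Q * (C c + C (-((Q.natDegree : k[X]) * (1 - X))) * Y)) :
    c.eval 0 = 0 ∧ ∀ j, j ≠ Q.natDegree → (Q.coeff j).eval 0 = 0 := by
  have hex := exists_eval_coeff_ne_zero hQ hd 0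
  have key : ∀ j, -(j * (Q.coeff j).eval 0) =
      (Q.coeff (j + 1)).eval 0 * c.eval 0 - (Q.coeff j).eval 0 * Q.natDegree := by
    intro j
    have h1 := congrArg (fun P : k[X][Y] => (P.coeff (j + 1)).eval 0) hc
    simp only [coeff_succ_riccatiD, coeff_succ_mul_linear] at h1
    simpa [← sub_eq_add_neg] using h1
  have key0 : (Q.coeff 0).eval 0 * c.eval 0 = 0 := by
    have h1 := congrArg (fun P : k[X][Y] => (P.coeff 0).eval 0) hc
    simp only [coeff_zero_riccatiD, coeff_zero_mul_linear] at h1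
    simpa using h1
  have hγ : c.eval 0 = 0 := by
    classical
    by_contra hne
    have : ∀ j, (Q.coeff j).eval 0 = 0 := by
      intro j
      induction j with
      | zero => exact (mul_eq_zero.1 key0).resolve_right hne
      | succ j ih =>
        have h1 := key j
        rw [ih] at h1
        simpa [hne] using h1.symm
    obtain ⟨j, hj⟩ := hex
    exact hj (this j)
  refine ⟨hγ, fun j hj => ?_⟩
  rcases lt_or_gt_of_ne hj with hlt | hgt
  · have h1 := key j
    rw [hγ, mul_zero, zero_sub, neg_inj, mul_comm] at h1
    have h2 : (Q.coeff j).eval 0 * ((Q.natDegree - j : ℕ) : k) = 0 := by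
      rw [Nat.cast_sub hlt.le]
      linear_combination -h1
    refine (mul_eq_zero.1 h2).resolve_right fun h0 => ?_
    have := Nat.le_of_dvd (by omega) ((CharP.cast_eq_zero_iff k p _).1 h0)
    omega
  · rw [coeff_eq_zero_of_natDegree_lt hgt, eval_zero]

lemma constantCoeff_ev {u : PowerSeries k} (hu : PowerSeries.X ∣ u) (P : k[X][Y]) :
    PowerSeries.constantCoeff (ev u P) = (P.coeff 0).eval 0 := by
  have hu' : PowerSeries.constantCoeff u = 0 := PowerSeries.X_dvd_iff.1 hu
  conv_lhs => rw [← divX_mul_X_add P]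
  rw [map_add, map_mul, ev_X, ev_C, map_add, map_mul, hu', mul_zero, zero_add,
    constantCoeff_coe, coeff_zero_eq_eval_zero]

lemma eq_of_mul_add_mul_eq {R : Type*} [CommRing R] {q q' l l' w z : R}
    (h : q' * l + q * l' = w + z * q') : w = (l - z) * q' + q * l' := by
  linear_combination -h

lemma natDegree_eq_one_of_invariant {p : ℕ} [CharP k p] {α γ : k} {u : PowerSeries k}
    (hu : IsRiccati α γ u) (hu0 : PowerSeries.X ∣ u) {A d : ℕ} {Q : k[X][Y]} {c : k[X]}
    (hQ : Irreducible Q) (hd0 : Q.natDegree ≠ 0) (hA : innerDegree Q ≤ A) (hd : Q.natDegree ≤ d)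
    (hn : 2 * (A + 1) * (d + 1) ≤ p) (hQu : PowerSeries.X ∣ ev u Q)
    (hc : riccatiD α γ Q = Q * (C c + C (-((Q.natDegree : k[X]) * (1 - X))) * Y)) :
    Q.natDegree = 1 := by
  have hdp : Q.natDegree < p := by nlinarith
  obtain ⟨hc0, hQ0⟩ := coeff_eval_zero_of_invariant hQ hd0 hdp hc
  by_contra hne
  set L : k[X][Y] := C c + C (-((Q.natDegree : k[X]) * (1 - X))) * Y with hL
  have h1 : PowerSeries.X ^ p ∣ ev u Q := by
    refine X_pow_dvd_of_derivative_eq (κ := ev u L) (t := 0) ?_ hQu ?_ (dvd_zero _)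
    · rw [PowerSeries.X_dvd_iff, constantCoeff_ev hu0, hL]
      simpa using hc0
    · rw [← ev_riccatiD hu, hc, map_mul]; ring
  have h2 : PowerSeries.X ^ p ∣ ev u (derivative Q) := by
    refine X_pow_dvd_of_derivative_eq (κ := ev u (L - (C (X * C α) - 2 * C (1 - X) * Y)))
      (t := ev u Q * ev u (derivative L)) ?_ ?_ ?_ (h1.mul_right _)
    · rw [PowerSeries.X_dvd_iff, constantCoeff_ev hu0, hL]
      simpa [mul_coeff_zero] using hc0
    · rw [PowerSeries.X_dvd_iff, constantCoeff_ev hu0, coeff_derivative]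
      simp [hQ0 1 (Ne.symm hne)]
    · rw [← ev_riccatiD hu, ← map_mul, ← map_mul, ← map_add]
      have h3 := derivative_riccatiD α γ Q
      rw [hc, derivative_mul] at h3
      exact congrArg (ev u) (eq_of_mul_add_mul_eq h3)
  have h3 : derivative Q ≠ 0 := by
    intro h0
    have h4 := congrArg (fun P : k[X][Y] => P.coeff (Q.natDegree - 1)) h0
    simp only [coeff_derivative, coeff_zero] at h4
    rw [Nat.sub_add_cancel (by omega)] at h4
    have h5 : ((Q.natDegree : ℕ) : k) = 0 := by
      have h6 := (mul_eq_zero.1 h4).resolve_left (leadingCoeff_ne_zero.2 hQ.ne_zero)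
      have h7 := congrArg (eval 0) h6
      rw [← Nat.cast_succ, Nat.succ_eq_add_one, Nat.sub_add_cancel (by omega)] at h7
      simpa using h7
    have := Nat.le_of_dvd (by omega) ((CharP.cast_eq_zero_iff k p _).1 h5)
    omega
  have hlt : (derivative Q).natDegree < Q.natDegree := natDegree_derivative_lt hd0
  have h4 : ¬ Q ∣ derivative Q := fun h => by
    have := natDegree_le_of_dvd h h3
    omega
  have h5 := le_of_X_pow_dvd_ev hQ hd0 h4 h1 h2
  have h6 : innerDegree (derivative Q) ≤ A := by
    refine innerDegree_le _ _ fun i => ?_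
    rw [coeff_derivative, show ((i : k[X]) + 1) = C ((i : k) + 1) by simp, mul_comm]
    exact ((natDegree_C_mul_le _ _).trans (natDegree_coeff_le_innerDegree _ _)).trans hA
  have h7 := Nat.mul_le_mul hA (hlt.le.trans hd)
  have h8 := Nat.mul_le_mul h6 hd
  nlinarith

lemma not_invariant_of_natDegree_eq_one {a b κ : k} {A : ℕ} {Q : k[X][Y]} (hQ : Irreducible Q)
    (hd : Q.natDegree = 1) (hA : innerDegree Q ≤ A)
    (hab : ∀ e : ℕ, e ≤ A → (e : k) ≠ a ∧ (e : k) ≠ b ∧ (e : k) ≠ -a ∧ (e : k) ≠ -b)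
    (hc : riccatiD (a + b) (a * b) Q =
      Q * (C (C κ * X) + C (-((Q.natDegree : k[X]) * (1 - X))) * Y)) : False := by
  set q₀ := Q.coeff 0 with hq₀
  set q₁ := Q.coeff 1 with hq₁
  have hq1 : q₁ ≠ 0 := by
    rw [hq₁, ← hd]; exact leadingCoeff_ne_zero.2 hQ.ne_zero
  have E0 : (1 - X) * derivative q₀ + C (a * b) * q₁ = C κ * q₀ := by
    have h1 := congrArg (fun P : k[X][Y] => P.coeff 0) hc
    simp only [coeff_zero_riccatiD, coeff_zero_mul_linear] at h1
    apply mul_left_cancel₀ (X_ne_zero (R := k))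
    linear_combination h1
  have E1 : X * ((1 - X) * derivative q₁ + C (a + b) * q₁ - C κ * q₁) = -((1 - X) * q₀) := by
    have h1 := congrArg (fun P : k[X][Y] => P.coeff (0 + 1)) hc
    simp only [coeff_succ_riccatiD, coeff_succ_mul_linear, hd,
      coeff_eq_zero_of_natDegree_lt (show Q.natDegree < 0 + 2 by omega)] at h1
    simp only [zero_add, ← hq₀, ← hq₁] at h1
    push_cast at h1
    linear_combination h1
  set e := q₁.natDegree with he
  have heA : e ≤ A := (natDegree_coeff_le_innerDegree Q 1).trans hA
  have hder : ∀ (f : k[X]) (n : ℕ), f.natDegree ≤ n →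
      ((1 - X) * derivative f).coeff n = -(n * f.coeff n) := by
    intro f n hf
    rw [sub_mul, one_mul, coeff_sub, coeff_derivative,
      coeff_eq_zero_of_natDegree_lt (Nat.lt_succ_of_le hf), zero_mul, zero_sub]
    rcases n with _ | n
    · simp
    · rw [coeff_X_mul, coeff_derivative]; push_cast; ring
  have hq0e : q₀.natDegree ≤ e := by
    rw [natDegree_le_iff_coeff_eq_zero]
    intro N hN
    have h1 : ∀ n, e < n → ((1 - X) * q₀).coeff (n + 1) = 0 := by
      intro n hn
      have h2 := congrArg (fun f : k[X] => f.coeff (n + 1)) E1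
      simp only [coeff_X_mul, coeff_add, coeff_sub, coeff_C_mul, coeff_neg] at h2
      rw [hder q₁ n hn.le, coeff_eq_zero_of_natDegree_lt hn] at h2
      simpa using h2.symm
    by_contra hne
    have hq0 : q₀ ≠ 0 := fun h => hne (by rw [h, coeff_zero])
    have h2 := le_natDegree_of_ne_zero hne
    have h3 := h1 q₀.natDegree (by omega)
    rw [sub_mul, one_mul, coeff_sub, coeff_X_mul,
      coeff_eq_zero_of_natDegree_lt (Nat.lt_succ_self _), zero_sub, neg_eq_zero] at h3
    exact hq0 (leadingCoeff_eq_zero.1 h3)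
  have F0 := congrArg (fun f : k[X] => f.coeff e) E0
  simp only [coeff_add, hder q₀ e hq0e, coeff_C_mul] at F0
  have F1 := congrArg (fun f : k[X] => f.coeff (e + 1)) E1
  simp only [coeff_X_mul, coeff_add, coeff_sub, hder q₁ e le_rfl, coeff_C_mul, coeff_neg] at F1
  rw [sub_mul, one_mul, coeff_sub, coeff_X_mul,
    coeff_eq_zero_of_natDegree_lt (Nat.lt_succ_of_le hq0e)] at F1
  have hQ1 : q₁.coeff e ≠ 0 := leadingCoeff_ne_zero.2 hq1
  have hquad : (κ + e - a) * (κ + e - b) = 0 := by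
    apply mul_left_cancel₀ hQ1
    linear_combination -(κ + e) * F1 + F0
  have G0 := congrArg (eval 1) E0
  have G1 := congrArg (eval 1) E1
  simp only [eval_add, eval_mul, eval_sub, eval_one, eval_X, sub_self, zero_mul, zero_add, eval_C,
    one_mul, eval_neg, neg_zero] at G0 G1
  obtain ⟨n1, n2, n3, n4⟩ := hab e heA
  have hκ : κ = 0 ∨ κ = a + b := by
    by_cases h1 : q₁.eval 1 = 0
    · left
      rw [h1, mul_zero, eq_comm] at G0
      refine (mul_eq_zero.1 G0).resolve_right fun h0 => ?_
      obtain ⟨j, hj⟩ := exists_eval_coeff_ne_zero hQ (by omega) 1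
      rcases j with _ | _ | j
      · exact hj h0
      · exact hj h1
      · exact hj (by rw [coeff_eq_zero_of_natDegree_lt (by omega), eval_zero])
    · right
      rw [← sub_mul] at G1
      exact (sub_eq_zero.1 ((mul_eq_zero.1 G1).resolve_right h1)).symm
  rcases hκ with rfl | rfl <;> rcases mul_eq_zero.1 hquad with h | h
  · exact n1 (by linear_combination h)
  · exact n2 (by linear_combination h)
  · exact n4 (by linear_combination h)
  · exact n3 (by linear_combination h)

/-- A polynomial relation of small degree between `s` and the logarithmic derivative `u` of a
hypergeometric function cannot hold modulo `s ^ p`. -/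
theorem not_X_pow_dvd_ev {p : ℕ} [CharP k p] {a b : k} {u : PowerSeries k}
    (hu : IsRiccati (a + b) (a * b) u) (hu0 : PowerSeries.X ∣ u) {A d : ℕ}
    (hn : 2 * (A + 1) * (d + 1) ≤ p)
    (hab : ∀ e : ℕ, e ≤ A → (e : k) ≠ a ∧ (e : k) ≠ b ∧ (e : k) ≠ -a ∧ (e : k) ≠ -b)
    {P : k[X][Y]} (hP : P ≠ 0) (hA : innerDegree P ≤ A) (hd : P.natDegree ≤ d) :
    ¬ PowerSeries.X ^ p ∣ ev u P := by
  intro h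
  obtain ⟨Q, hQ, hQ0, hQA, hQd, hdvd, hQu⟩ := exists_invariant_factor hu hP hA hd hn h
  obtain ⟨c, hc1, hc⟩ := exists_cofactor hQ.ne_zero hdvd
  have h1 := natDegree_eq_one_of_invariant hu hu0 hQ hQ0 hQA hQd hn hQu hc
  obtain ⟨hc0, -⟩ := coeff_eval_zero_of_invariant hQ hQ0 (p := p) (by nlinarith) hc
  have hc' : c = C (c.coeff 1) * X := by
    conv_lhs => rw [eq_X_add_C_of_natDegree_le_one hc1]
    rw [coeff_zero_eq_eval_zero, hc0, C_0, add_zero]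
  rw [hc'] at hc
  exact not_invariant_of_natDegree_eq_one hQ h1 hQA hab hc

end ZeroEstimate

section Twist

open scoped Polynomial.Bivariate

variable {k : Type*} [Field k]

lemma innerDeriv_smul (c : k) (P : k[X][Y]) : innerDeriv (c • P) = c • innerDeriv P := by
  ext1 i
  simp only [coeff_innerDeriv, coeff_smul, derivative_smul]

lemma riccatiD_smul (α γ c : k) (P : k[X][Y]) : riccatiD α γ (c • P) = c • riccatiD α γ P := by
  simp only [riccatiD, innerDeriv_smul, derivative_smul, smul_add, mul_smul_comm]

/-- The derivation `riccatiD` transported to polynomials of degree at most `d`, viewed as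
binary forms of degree `d` in `s (dg/ds)` and `g`. -/
noncomputable def twist (α γ : k) (d : ℕ) : k[X][Y] →ₗ[k] k[X][Y] where
  toFun P := riccatiD α γ P + C ((d : k[X]) * (1 - X)) * Y * P
  map_add' P Q := by rw [riccatiD_add]; ring
  map_smul' c P := by
    rw [riccatiD_smul, RingHom.id_apply, smul_add, mul_smul_comm]

lemma twist_apply (α γ : k) (d : ℕ) (P : k[X][Y]) :
    twist α γ d P = riccatiD α γ P + C ((d : k[X]) * (1 - X)) * Y * P := rfl

lemma natDegree_twist_le {α γ : k} {d : ℕ} {P : k[X][Y]} (hP : P.natDegree ≤ d) :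
    (twist α γ d P).natDegree ≤ d := by
  rw [natDegree_le_iff_coeff_eq_zero]
  intro N hN
  obtain ⟨j, rfl⟩ : ∃ j, N = j + 1 := ⟨N - 1, by omega⟩
  rw [twist_apply, coeff_add, coeff_succ_riccatiD, mul_assoc (C _), coeff_C_mul, coeff_X_mul,
    coeff_eq_zero_of_natDegree_lt (by omega : P.natDegree < j + 1),
    coeff_eq_zero_of_natDegree_lt (by omega : P.natDegree < j + 2)]
  rcases (Nat.lt_succ_iff.1 hN).lt_or_eq with h | rfl
  · rw [coeff_eq_zero_of_natDegree_lt (by omega : P.natDegree < j)]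
    simp
  · rw [derivative_zero]; ring

lemma innerDegree_add_le (P Q : k[X][Y]) :
    innerDegree (P + Q) ≤ max (innerDegree P) (innerDegree Q) := by
  rw [innerDegree, map_add]
  exact natDegree_add_le _ _

lemma innerDegree_mul_le (P Q : k[X][Y]) :
    innerDegree (P * Q) ≤ innerDegree P + innerDegree Q := by
  rw [innerDegree, map_mul]
  exact natDegree_mul_le

lemma innerDegree_twist_le (α γ : k) (d : ℕ) (P : k[X][Y]) :
    innerDegree (twist α γ d P) ≤ innerDegree P + 1 := by
  rw [twist_apply]
  refine (innerDegree_add_le _ _).trans (max_le (innerDegree_riccatiD_le _ _ _) ?_)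
  refine (innerDegree_mul_le _ _).trans ?_
  rw [add_comm]
  gcongr
  refine innerDegree_le _ _ fun i => ?_
  have h1 : ((d : k[X]) * (1 - X)).natDegree ≤ 1 := by
    rw [show (d : k[X]) = C (d : k) by simp]
    refine (natDegree_C_mul_le _ _).trans ?_
    refine (natDegree_sub_le _ _).trans (by simp)
  rcases i with _ | _ | i
  · simp
  · rw [coeff_C_mul, coeff_X_one, mul_one]; exact h1
  · rw [coeff_C_mul, coeff_X_of_ne_one (by omega), mul_zero]; simp

lemma natDegree_twist_pow_le {α γ : k} {d : ℕ} {P : k[X][Y]} (hP : P.natDegree ≤ d) (m : ℕ) :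
    ((twist α γ d ^ m) P).natDegree ≤ d := by
  induction m with
  | zero => simpa using hP
  | succ m ih => rw [pow_succ', Module.End.mul_apply]; exact natDegree_twist_le ih

lemma innerDegree_twist_pow_le (α γ : k) (d : ℕ) (P : k[X][Y]) (m : ℕ) :
    innerDegree ((twist α γ d ^ m) P) ≤ innerDegree P + m := by
  induction m with
  | zero => simp
  | succ m ih =>
    rw [pow_succ', Module.End.mul_apply]
    exact (innerDegree_twist_le _ _ _ _).trans (by omega)

/-- The bivariate polynomial with a given rectangular array of coefficients. -/
noncomputable def ofArray (A d : ℕ) : (Fin (d + 1) × Fin A → k) →ₗ[k] k[X][Y] where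
  toFun v := ∑ x, monomial (x.1 : ℕ) (monomial (x.2 : ℕ) (v x))
  map_add' v w := by simp [Finset.sum_add_distrib]
  map_smul' c v := by simp [Finset.smul_sum, smul_monomial]

lemma coeff_coeff_ofArray (A d : ℕ) (v : Fin (d + 1) × Fin A → k) (i j : ℕ) :
    ((ofArray A d v).coeff i).coeff j =
      if h : i < d + 1 ∧ j < A then v (⟨i, h.1⟩, ⟨j, h.2⟩) else 0 := by
  simp only [ofArray, LinearMap.coe_mk, AddHom.coe_mk, finsetSum_coeff, coeff_monomial,
    apply_ite (fun f : k[X] => f.coeff j), coeff_zero]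
  split_ifs with h
  · rw [Finset.sum_eq_single (⟨i, h.1⟩, ⟨j, h.2⟩)]
    · simp
    · rintro ⟨⟨a, ha⟩, ⟨b, hb⟩⟩ - hne
      simp only [ne_eq, Prod.mk.injEq, Fin.mk.injEq, not_and] at hne
      split_ifs with h1 h2
      · exact absurd h2 (hne h1)
      · rfl
      · rfl
    · simp
  · refine Finset.sum_eq_zero ?_
    rintro ⟨⟨a, ha⟩, ⟨b, hb⟩⟩ -
    split_ifs with h1 h2
    · exact absurd ⟨by simpa [← h1] using ha, by simpa [← h2] using hb⟩ h
    · rfl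
    · rfl

lemma ofArray_eq_zero {A d : ℕ} {v : Fin (d + 1) × Fin A → k} (h : ofArray A d v = 0) :
    v = 0 := by
  ext ⟨⟨i, hi⟩, ⟨j, hj⟩⟩
  have h1 := coeff_coeff_ofArray A d v i j
  rw [h, dif_pos ⟨hi, hj⟩] at h1
  simpa using h1.symm

lemma natDegree_ofArray_le (A d : ℕ) (v : Fin (d + 1) × Fin A → k) :
    (ofArray A d v).natDegree ≤ d := by
  rw [natDegree_le_iff_coeff_eq_zero]
  intro N hN
  ext j
  rw [coeff_coeff_ofArray, dif_neg (by omega), coeff_zero]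

lemma innerDegree_ofArray_le (A d : ℕ) (v : Fin (d + 1) × Fin A → k) :
    innerDegree (ofArray A d v) ≤ A - 1 := by
  refine innerDegree_le _ _ fun i => ?_
  rw [natDegree_le_iff_coeff_eq_zero]
  intro N hN
  rw [coeff_coeff_ofArray, dif_neg (by omega)]

lemma exists_auxiliary (α γ : k) {A B M d : ℕ} (hA : 0 < A)
    (h : M * (A + B + M) < A * B * (d + 1)) :
    ∃ P : Fin B → k[X][Y], P ≠ 0 ∧ (∀ b, (P b).natDegree ≤ d) ∧
      (∀ b, innerDegree (P b) ≤ A - 1) ∧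
      ∀ m < M, ∑ b : Fin B, X ^ (b : ℕ) * ((twist α γ d ^ m) (P b)).coeff d = 0 := by
  let φ : (Fin B → Fin (d + 1) × Fin A → k) →ₗ[k] (Fin M × Fin (A + B + M) → k) :=
    LinearMap.pi fun x => (lcoeff k (x.2 : ℕ)) ∘ₗ
      ∑ b : Fin B, (LinearMap.mulLeft k (X ^ (b : ℕ) : k[X])) ∘ₗ
        ((lcoeff k[X] d).restrictScalars k) ∘ₗ (twist α γ d ^ (x.1 : ℕ)) ∘ₗ (ofArray A d) ∘ₗ
          LinearMap.proj b
  have hlt : Module.finrank k (Fin M × Fin (A + B + M) → k) <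
      Module.finrank k (Fin B → Fin (d + 1) × Fin A → k) := by
    rw [Module.finrank_fintype_fun_eq_card, Module.finrank_pi_fintype]
    simp only [Module.finrank_fintype_fun_eq_card, Fintype.card_prod, Fintype.card_fin,
      Finset.sum_const, Finset.card_univ, smul_eq_mul]
    calc _ < _ := h
      _ = _ := by ring
  obtain ⟨v, hv, hv0⟩ := (Submodule.ne_bot_iff _).1 (LinearMap.ker_ne_bot_of_finrank_lt hlt (f := φ))
  refine ⟨fun b => ofArray A d (v b), ?_, fun b => natDegree_ofArray_le _ _ _,
    fun b => innerDegree_ofArray_le _ _ _, fun m hm => ?_⟩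
  · intro h0
    exact hv0 (funext fun b => ofArray_eq_zero (congrFun h0 b))
  · ext j
    rw [coeff_zero]
    by_cases hj : j < A + B + M
    · have h1 := congrFun (LinearMap.mem_ker.1 hv) (⟨m, hm⟩, ⟨j, hj⟩)
      simpa [φ] using h1
    · apply coeff_eq_zero_of_natDegree_lt
      refine lt_of_le_of_lt (natDegree_sum_le_of_forall_le (n := B + (A - 1 + m)) _ _ fun b _ => ?_)
        (by omega)
      refine natDegree_mul_le.trans (add_le_add ?_ ?_)
      · rw [natDegree_X_pow]; exact b.2.le
      · exact ((natDegree_coeff_le_innerDegree _ _).trans (innerDegree_twist_pow_le _ _ _ _ _)).trans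
          (Nat.add_le_add_right (innerDegree_ofArray_le _ _ _) _)

end Twist

section Stepanov

open scoped Polynomial.Bivariate

variable {k : Type*} [Field k]

/-- The hypergeometric differential equation with parameters `a + b = α`, `ab = γ`, `c = 1`. -/
def IsHypergeometric (α γ : k) (g : k[X]) : Prop :=
  X * (1 - X) * derivative (derivative g) + (1 - (C α + 1) * X) * derivative g - C γ * g = 0

/-- The power series expansion of `s (dg/ds) / g`. -/
noncomputable def logDeriv (g : k[X]) : PowerSeries k :=
  ((X * derivative g : k[X]) : PowerSeries k) * (g : PowerSeries k)⁻¹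

lemma logDeriv_mul {g : k[X]} (hg : g.eval 0 ≠ 0) :
    logDeriv g * (g : PowerSeries k) = ((X * derivative g : k[X]) : PowerSeries k) := by
  rw [logDeriv, mul_assoc, PowerSeries.inv_mul_cancel, mul_one]
  rwa [constantCoeff_coe, coeff_zero_eq_eval_zero]

lemma X_dvd_logDeriv (g : k[X]) : PowerSeries.X ∣ logDeriv g := by
  rw [logDeriv, coe_mul, coe_X, mul_assoc]
  exact dvd_mul_right _ _

lemma coe_ne_zero_of_eval_ne_zero {g : k[X]} (hg : g.eval 0 ≠ 0) : (g : PowerSeries k) ≠ 0 := by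
  intro h
  rw [coe_eq_zero_iff] at h
  simp [h] at hg

lemma isRiccati_logDeriv {α γ : k} {g : k[X]} (hg : g.eval 0 ≠ 0)
    (hode : IsHypergeometric α γ g) : IsRiccati α γ (logDeriv g) := by
  have hg0 := coe_ne_zero_of_eval_ne_zero hg
  have h1 := logDeriv_mul hg
  have h2 := congrArg (PowerSeries.derivative k) h1
  have h3 := congrArg (fun f : k[X] => (f : PowerSeries k)) hode
  simp only [coe_sub, coe_add, coe_mul, coe_X, coe_one, coe_C, coe_zero] at h3
  simp only [coe_mul, coe_X] at h1
  rw [Derivation.leibniz, PowerSeries.derivative_coe, PowerSeries.derivative_coe, derivative_mul,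
    derivative_X, one_mul] at h2
  simp only [coe_mul, coe_X, smul_eq_mul, coe_add] at h2
  rw [IsRiccati]
  set u := logDeriv g
  set G : PowerSeries k := (g : PowerSeries k)
  set G1 : PowerSeries k := ((derivative g : k[X]) : PowerSeries k)
  set G2 : PowerSeries k := ((derivative (derivative g) : k[X]) : PowerSeries k)
  apply mul_right_cancel₀ (pow_ne_zero 2 hg0)
  linear_combination (PowerSeries.X * (1 - PowerSeries.X) * G) * h2 +
    (PowerSeries.X * G) * h3 +
    ((1 - PowerSeries.X) * G * u - PowerSeries.X * PowerSeries.C α * G) * h1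

/-- The binary form of degree `d` in `s (dg/ds)` and `g` attached to a bivariate polynomial. -/
noncomputable def formEval (g : k[X]) (d : ℕ) (P : k[X][Y]) : k[X] :=
  ∑ i ∈ Finset.range (d + 1), P.coeff i * (X * derivative g) ^ i * g ^ (d - i)

lemma coe_formEval {g : k[X]} (hg : g.eval 0 ≠ 0) {d : ℕ} {P : k[X][Y]} (hP : P.natDegree ≤ d) :
    (formEval g d P : PowerSeries k) = (g : PowerSeries k) ^ d * ev (logDeriv g) P := by
  rw [ev, coe_eval₂RingHom, eval₂_eq_sum_range' _ (Nat.lt_succ_of_le hP), formEval,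
    ← coeToPowerSeries.ringHom_apply, map_sum, Finset.mul_sum]
  refine Finset.sum_congr rfl fun i hi => ?_
  have hid : i ≤ d := Nat.lt_succ_iff.1 (Finset.mem_range.1 hi)
  rw [map_mul, map_mul, map_pow, map_pow, coeToPowerSeries.ringHom_apply,
    coeToPowerSeries.ringHom_apply, coeToPowerSeries.ringHom_apply, ← logDeriv_mul hg]
  conv_rhs => rw [← Nat.sub_add_cancel hid, pow_add]
  rw [mul_pow]
  ring

lemma derivative_formEval {α γ : k} {g : k[X]} (hg : g.eval 0 ≠ 0)
    (hode : IsHypergeometric α γ g) {d : ℕ} {P : k[X][Y]} (hP : P.natDegree ≤ d) :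
    X * (1 - X) * derivative (formEval g d P) = formEval g d (twist α γ d P) := by
  apply coe_injective k
  rw [coe_formEval hg (natDegree_twist_le hP), twist_apply, map_add,
    ev_riccatiD (isRiccati_logDeriv hg hode), coe_mul, ← PowerSeries.derivative_coe,
    coe_formEval hg hP, Derivation.leibniz, Derivation.leibniz_pow, PowerSeries.derivative_coe]
  have h1 := logDeriv_mul hg
  rcases d with _ | d
  · simp
  · simp only [map_mul, ev_C, ev_X, coe_mul, coe_sub, coe_one, coe_X, smul_eq_mul,
      Nat.add_sub_cancel, nsmul_eq_mul] at h1 ⊢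
    have h2 : (((d + 1 : ℕ) : k[X]) : PowerSeries k) = ((d + 1 : ℕ) : PowerSeries k) :=
      map_natCast (coeToPowerSeries.ringHom (R := k)) _
    rw [h2]
    linear_combination (-((d + 1 : ℕ) : PowerSeries k) * (1 - PowerSeries.X) *
      (g : PowerSeries k) ^ d * ev (logDeriv g) P) * h1

lemma eval_formEval {g : k[X]} {s : k} (hs : g.eval s = 0) (d : ℕ) (P : k[X][Y]) :
    (formEval g d P).eval s = (P.coeff d).eval s * (s * (derivative g).eval s) ^ d := by
  rw [formEval, eval_finsetSum, Finset.sum_eq_single d]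
  · simp
  · intro i hi hne
    have : d - i ≠ 0 := by have := Finset.mem_range.1 hi; omega
    simp [hs, this]
  · simp

lemma natDegree_formEval_le {g : k[X]} {d : ℕ} {P : k[X][Y]} :
    (formEval g d P).natDegree ≤ innerDegree P + d * g.natDegree := by
  have h1 : (X * derivative g).natDegree ≤ g.natDegree := by
    rcases Nat.eq_zero_or_pos g.natDegree with h | h
    · rw [eq_C_of_natDegree_eq_zero h]; simp
    · refine natDegree_mul_le.trans ?_
      have := natDegree_derivative_lt h.ne'
      rw [natDegree_X]; omega
  refine natDegree_sum_le_of_forall_le _ _ fun i hi => ?_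
  have hid : i ≤ d := Nat.lt_succ_iff.1 (Finset.mem_range.1 hi)
  calc _ ≤ innerDegree P + i * g.natDegree + (d - i) * g.natDegree := by
        refine natDegree_mul_le.trans (add_le_add (natDegree_mul_le.trans (add_le_add ?_ ?_)) ?_)
        · exact natDegree_coeff_le_innerDegree _ _
        · exact natDegree_pow_le.trans (Nat.mul_le_mul_left _ h1)
        · exact natDegree_pow_le
    _ = _ := by rw [add_assoc, ← add_mul, Nat.add_sub_cancel' hid]

/-- The derivation `s(1-s) d/ds`. -/
noncomputable def eulerD (f : k[X]) : k[X] := X * (1 - X) * derivative f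

lemma pow_dvd_of_iterate_eulerD {p : ℕ} [CharP k p] {s : k} (hs : s * (1 - s) ≠ 0) (M : ℕ) :
    M ≤ p → ∀ f : k[X], (∀ m < M, (eulerD^[m] f).eval s = 0) → (X - C s) ^ M ∣ f := by
  induction M with
  | zero => simp
  | succ M ih =>
    intro hM f hf
    by_cases hf0 : f = 0
    · simp [hf0]
    have h1 : (X - C s) ^ M ∣ eulerD f := by
      refine ih (by omega) _ fun m hm => ?_
      rw [← Function.iterate_succ_apply]
      exact hf (m + 1) (by omega)
    have h2 : (X - C s) ^ M ∣ derivative f := by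
      refine (IsCoprime.pow_left ?_).dvd_of_dvd_mul_left h1
      rw [(irreducible_X_sub_C s).coprime_iff_not_dvd, dvd_iff_isRoot]
      simpa using hs
    obtain ⟨q, hq, hqs⟩ := exists_eq_pow_rootMultiplicity_mul_and_not_dvd f hf0 s
    set n := rootMultiplicity s f with hn
    by_contra hnd
    have hnM : n ≤ M := by
      by_contra! h
      exact hnd ((pow_dvd_pow _ h).trans (hq ▸ dvd_mul_right _ _))
    have hn0 : n ≠ 0 := by
      intro h0
      rw [h0, pow_zero, one_mul] at hq
      exact hqs (hq ▸ dvd_iff_isRoot.2 (hf 0 (by omega)))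
    obtain ⟨j, hj⟩ : ∃ j, n = j + 1 := ⟨n - 1, by omega⟩
    have h3 : (X - C s) ^ (j + 1) ∣ (X - C s) ^ j * (C ((j + 1 : ℕ) : k) * q + (X - C s) * derivative q) := by
      refine ((pow_dvd_pow _ (by omega)).trans h2).trans (dvd_of_eq ?_)
      rw [hq, hj, derivative_mul, derivative_X_sub_C_pow, Nat.add_sub_cancel]
      ring
    rw [pow_succ, mul_dvd_mul_iff_left (pow_ne_zero _ (X_sub_C_ne_zero s))] at h3
    have h4 := (dvd_add_left (dvd_mul_right _ _)).1 h3
    rcases (prime_X_sub_C s).dvd_or_dvd h4 with h | h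
    · rw [dvd_iff_isRoot, IsRoot.def, eval_C, CharP.cast_eq_zero_iff k p] at h
      have := Nat.le_of_dvd (by omega) h
      omega
    · exact hqs h

lemma eulerD_sum {ι : Type*} {p : ℕ} [CharP k p] (t : Finset ι) (e : ι → ℕ) (f : ι → k[X]) :
    eulerD (∑ b ∈ t, X ^ (p * e b) * f b) = ∑ b ∈ t, X ^ (p * e b) * eulerD (f b) := by
  rw [eulerD, derivative_sum, Finset.mul_sum]
  refine Finset.sum_congr rfl fun b _ => ?_
  rw [derivative_mul, derivative_X_pow, Nat.cast_mul, CharP.cast_eq_zero, zero_mul, C_0, zero_mul,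
    zero_mul, zero_add, eulerD]
  ring

lemma iterate_eulerD_formEval {α γ : k} {g : k[X]} (hg : g.eval 0 ≠ 0)
    (hode : IsHypergeometric α γ g) {d : ℕ} {ι : Type*} {p : ℕ} [CharP k p] (t : Finset ι)
    (e : ι → ℕ) (P : ι → k[X][Y]) (hP : ∀ b, (P b).natDegree ≤ d) (m : ℕ) :
    eulerD^[m] (∑ b ∈ t, X ^ (p * e b) * formEval g d (P b)) =
      ∑ b ∈ t, X ^ (p * e b) * formEval g d ((twist α γ d ^ m) (P b)) := by
  induction m with
  | zero => simp
  | succ m ih =>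
    rw [Function.iterate_succ_apply', ih, eulerD_sum]
    refine Finset.sum_congr rfl fun b _ => ?_
    rw [eulerD, derivative_formEval hg hode (natDegree_twist_pow_le (hP b) m), pow_succ',
      Module.End.mul_apply]

lemma sum_formEval_ne_zero {p : ℕ} [CharP k p] {a b : k} {g : k[X]} (hg : g.eval 0 ≠ 0)
    (hode : IsHypergeometric (a + b) (a * b) g) {A d B : ℕ} (hn : 2 * (A + 1) * (d + 1) ≤ p)
    (hab : ∀ e : ℕ, e ≤ A → (e : k) ≠ a ∧ (e : k) ≠ b ∧ (e : k) ≠ -a ∧ (e : k) ≠ -b)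
    {P : Fin B → k[X][Y]} (hP : P ≠ 0) (hd : ∀ i, (P i).natDegree ≤ d)
    (hA : ∀ i, innerDegree (P i) ≤ A) :
    ∑ i : Fin B, X ^ (p * (i : ℕ)) * formEval g d (P i) ≠ 0 := by
  classical
  intro h0
  have hne : (Finset.univ.filter fun i => P i ≠ 0).Nonempty := by
    obtain ⟨i, hi⟩ := Function.ne_iff.1 hP
    exact ⟨i, by simpa using hi⟩
  obtain ⟨i, hi, hmin⟩ := Finset.exists_min_image _ id hne
  have hi0 : P i ≠ 0 := by simpa using hi
  have h1 : X ^ (p * (i + 1 : ℕ)) ∣ X ^ (p * (i : ℕ)) * formEval g d (P i) := by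
    rw [← Finset.add_sum_erase _ _ (Finset.mem_univ i)] at h0
    rw [eq_neg_of_add_eq_zero_left h0, dvd_neg]
    refine Finset.dvd_sum fun j hj => ?_
    by_cases hj0 : P j = 0
    · simp [formEval, hj0]
    · have h2 := hmin j (by simpa using hj0)
      have h3 : i < j := lt_of_le_of_ne h2 (Finset.ne_of_mem_erase hj).symm
      exact (pow_dvd_pow _ (Nat.mul_le_mul_left _ h3)).trans (dvd_mul_right _ _)
  rw [mul_add, mul_one, pow_add, mul_dvd_mul_iff_left (pow_ne_zero _ X_ne_zero)] at h1
  have h2 : (PowerSeries.X : PowerSeries k) ^ p ∣ (g : PowerSeries k) ^ d * ev (logDeriv g) (P i) := by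
    rw [← coe_formEval hg (hd i), ← coe_X, ← coe_pow]
    exact map_dvd (coeToPowerSeries.ringHom (R := k)) h1
  have h3 : IsUnit ((g : PowerSeries k) ^ d) := by
    refine IsUnit.pow _ ?_
    rw [PowerSeries.isUnit_iff_constantCoeff, constantCoeff_coe, coeff_zero_eq_eval_zero]
    exact hg.isUnit
  exact not_X_pow_dvd_ev (isRiccati_logDeriv hg hode) (X_dvd_logDeriv g) hn hab hi0 (hA i) (hd i)
    (h3.dvd_mul_left.1 h2)

/-- The Stepanov method for the roots of a polynomial solution of a hypergeometric equation. -/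
theorem card_roots_mul_le {p : ℕ} [CharP k p] {a b : k} {g : k[X]} (hg : g.eval 0 ≠ 0)
    (hode : IsHypergeometric (a + b) (a * b) g) {A d B M : ℕ} (hM : M ≤ p)
    (hn : 2 * (A + 1) * (d + 1) ≤ p)
    (hab : ∀ e : ℕ, e ≤ A → (e : k) ≠ a ∧ (e : k) ≠ b ∧ (e : k) ≠ -a ∧ (e : k) ≠ -b)
    (hlt : M * (A + 1 + B + M) < (A + 1) * B * (d + 1)) (Z : Finset k)
    (hZ : ∀ s ∈ Z, g.eval s = 0 ∧ s ^ p = s ∧ s ≠ 1) :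
    Z.card * M ≤ p * B + (A + d * g.natDegree) := by
  obtain ⟨P, hP, hd, hA, hvan⟩ := exists_auxiliary (a + b) (a * b) (Nat.succ_pos A) hlt
  simp only [Nat.succ_eq_add_one, Nat.add_sub_cancel] at hA
  set F := ∑ i : Fin B, X ^ (p * (i : ℕ)) * formEval g d (P i) with hF
  have hF0 : F ≠ 0 := sum_formEval_ne_zero hg hode hn hab hP hd hA
  have hdvd : ∀ s ∈ Z, (X - C s) ^ M ∣ F := by
    intro s hs
    obtain ⟨h1, h2, h3⟩ := hZ s hs
    have h4 : s ≠ 0 := by rintro rfl; exact hg h1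
    refine pow_dvd_of_iterate_eulerD (p := p)
      (mul_ne_zero h4 (sub_ne_zero.2 h3.symm)) M hM F fun m hm => ?_
    rw [hF, iterate_eulerD_formEval hg hode _ _ _ hd, eval_finsetSum]
    have h5 := congrArg (eval s) (hvan m hm)
    rw [eval_finsetSum, eval_zero] at h5
    calc _ = (∑ i : Fin B, eval s (X ^ (i : ℕ) * ((twist (a + b) (a * b) d ^ m) (P i)).coeff d)) *
          (s * (derivative g).eval s) ^ d := by
          rw [Finset.sum_mul]
          refine Finset.sum_congr rfl fun i _ => ?_
          rw [eval_mul, eval_mul, eval_formEval h1, eval_pow, eval_pow, eval_X, pow_mul, h2, mul_assoc]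
      _ = 0 := by rw [h5, zero_mul]
  have hprod : ∏ s ∈ Z, (X - C s) ^ M ∣ F := by
    refine Finset.prod_dvd_of_coprime (fun s _ t _ hst => ?_) hdvd
    exact (pairwise_coprime_X_sub_C Function.injective_id hst).pow
  have hdeg := natDegree_le_of_dvd hprod hF0
  rw [natDegree_prod _ _ fun s _ => pow_ne_zero _ (X_sub_C_ne_zero s)] at hdeg
  simp only [natDegree_pow, natDegree_X_sub_C, mul_one, Finset.sum_const, smul_eq_mul] at hdeg
  refine hdeg.trans (natDegree_sum_le_of_forall_le _ _ fun i _ => ?_)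
  refine natDegree_mul_le.trans (add_le_add ?_ ?_)
  · rw [natDegree_X_pow]; exact Nat.mul_le_mul_left _ i.2.le
  · exact natDegree_formEval_le.trans (Nat.add_le_add_right (hA i) _)

/-- A polynomial solution of a hypergeometric equation has `O(p ^ (2/3))` roots in `𝔽_p`. -/
theorem card_roots_pow_three_le {p : ℕ} [CharP k p] {a b : k} {g : k[X]} (hg : g.eval 0 ≠ 0)
    (hode : IsHypergeometric (a + b) (a * b) g) (hp : 384 ≤ p) (hgp : g.natDegree ≤ p)
    (hab : ∀ e : ℕ, 24 * (e + 1) ≤ p →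
      (e : k) ≠ a ∧ (e : k) ≠ b ∧ (e : k) ≠ -a ∧ (e : k) ≠ -b) (Z : Finset k)
    (hZ : ∀ s ∈ Z, g.eval s = 0 ∧ s ^ p = s ∧ s ≠ 1) :
    Z.card ^ 3 ≤ 6000 * p ^ 2 := by
  obtain ⟨l, hl0, hl1, hl2⟩ : ∃ l, 0 < l ∧ 6 * l ^ 3 ≤ p ∧ p < 6 * (l + 1) ^ 3 := by
    have hex : ∃ n, p < 6 * (n + 1) ^ 3 := ⟨p, by nlinarith [Nat.zero_le p, sq_nonneg p]⟩
    classical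
    refine ⟨Nat.find hex, ?_, ?_, Nat.find_spec hex⟩
    · rw [Nat.find_pos]; omega
    · have h0 : 0 < Nat.find hex := by rw [Nat.find_pos]; omega
      have := Nat.find_min hex (Nat.sub_lt h0 Nat.one_pos)
      rw [show Nat.find hex - 1 + 1 = Nat.find hex by omega] at this
      omega
  have hll : 1 ≤ l ^ 2 := Nat.one_le_pow _ _ hl0
  have hl3 : l ^ 2 ≤ l ^ 3 := Nat.pow_le_pow_right hl0 (by norm_num)
  have hl4 : 4 ≤ l := by
    by_contra! h
    have : (l + 1) ^ 3 ≤ 4 ^ 3 := Nat.pow_le_pow_left (by omega) 3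
    omega
  have hl24 : 24 * l ^ 2 ≤ p := by nlinarith
  have hA1 : l ^ 2 - 1 + 1 = l ^ 2 := Nat.sub_add_cancel hll
  have h1 := card_roots_mul_le hg hode (A := l ^ 2 - 1) (d := 2 * l) (B := 2 * l) (M := l ^ 2)
    (by omega) (by rw [hA1]; nlinarith) (fun e he => hab e (by omega))
    (by rw [hA1]; nlinarith [pow_pos hl0 4]) Z hZ
  have h2 : Z.card * l ≤ 5 * p := by
    have h3 : 2 * l * g.natDegree ≤ 2 * l * p := Nat.mul_le_mul_left _ hgp
    have h4 : l ≤ p := by nlinarith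
    refine Nat.le_of_mul_le_mul_left ?_ hl0
    nlinarith [Nat.sub_le (l ^ 2) 1]
  have h3 : p ≤ 48 * l ^ 3 := by
    have : (l + 1) ^ 3 ≤ (2 * l) ^ 3 := Nat.pow_le_pow_left (by omega) 3
    nlinarith
  have h4 : Z.card ^ 3 * l ^ 3 ≤ 125 * p ^ 3 := by
    calc _ = (Z.card * l) ^ 3 := by ring
      _ ≤ (5 * p) ^ 3 := Nat.pow_le_pow_left h2 3
      _ = _ := by ring
  have h5 : Z.card ^ 3 * p ≤ 6000 * p ^ 2 * p := by
    calc _ ≤ Z.card ^ 3 * (48 * l ^ 3) := Nat.mul_le_mul_left _ h3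
      _ = 48 * (Z.card ^ 3 * l ^ 3) := by ring
      _ ≤ 48 * (125 * p ^ 3) := Nat.mul_le_mul_left _ h4
      _ = _ := by ring
  exact Nat.le_of_mul_le_mul_right h5 (by omega)

end Stepanov

section Hypergeometric

/-- The coefficients of the Hasse invariant of `y² = x³ + ax + b`, where `(p - 1) / 2 = 2q + δ`. -/
def hasseCoeff (q δ r : ℕ) : ℕ := (2 * q + δ).choose (q + δ + r) * (q - r).choose (δ + 2 * r)

lemma hasseCoeff_eq_zero {q δ r : ℕ} (h : q < δ + 3 * r) : hasseCoeff q δ r = 0 := by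
  rw [hasseCoeff]
  rcases le_or_gt r q with hr | hr
  · rw [Nat.choose_eq_zero_of_lt (by omega : q - r < δ + 2 * r), mul_zero]
  · rw [Nat.choose_eq_zero_of_lt (by omega : 2 * q + δ < q + δ + r), zero_mul]

open Nat in
lemma hasseCoeff_mul_factorial {q δ r : ℕ} (h : δ + 3 * r ≤ q) :
    hasseCoeff q δ r * ((δ + 2 * r)! * (q + δ + r)! * (q - δ - 3 * r)!) = (2 * q + δ)! := by
  have h1 := Nat.choose_mul_factorial_mul_factorial (by omega : q + δ + r ≤ 2 * q + δ)
  have h2 := Nat.choose_mul_factorial_mul_factorial (by omega : δ + 2 * r ≤ q - r)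
  rw [show 2 * q + δ - (q + δ + r) = q - r by omega] at h1
  rw [show q - r - (δ + 2 * r) = q - δ - 3 * r by omega] at h2
  rw [hasseCoeff, ← h1, ← h2]
  ring

open Nat in
lemma hasseCoeff_succ (q δ r : ℕ) :
    (hasseCoeff q δ (r + 1) : ℤ) * ((δ + 2 * r + 1) * (δ + 2 * r + 2) * (q + δ + r + 1)) =
      hasseCoeff q δ r * ((q - δ - 3 * r) * (q - δ - 3 * r - 1) * (q - δ - 3 * r - 2)) := by
  by_cases h1 : q < δ + 3 * r
  · rw [hasseCoeff_eq_zero h1, hasseCoeff_eq_zero (by omega)]; simp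
  by_cases h2 : q < δ + 3 * (r + 1)
  · rw [hasseCoeff_eq_zero h2]
    have h3 : ((q : ℤ) - δ - 3 * r) = 0 ∨ ((q : ℤ) - δ - 3 * r - 1) = 0 ∨
        ((q : ℤ) - δ - 3 * r - 2) = 0 := by omega
    rcases h3 with h3 | h3 | h3 <;> rw [h3] <;> simp
  · obtain ⟨w, rfl⟩ : ∃ w, q = δ + 3 * r + 3 + w := ⟨q - (δ + 3 * r + 3), by omega⟩
    have e1 := hasseCoeff_mul_factorial (q := δ + 3 * r + 3 + w) (δ := δ) (r := r) (by omega)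
    have e2 := hasseCoeff_mul_factorial (q := δ + 3 * r + 3 + w) (δ := δ) (r := r + 1) (by omega)
    rw [show δ + 3 * r + 3 + w - δ - 3 * r = w + 2 + 1 by omega] at e1
    rw [show δ + 3 * r + 3 + w - δ - 3 * (r + 1) = w by omega, ← e1,
      show δ + 2 * (r + 1) = δ + 2 * r + 1 + 1 by ring,
      show δ + 3 * r + 3 + w + δ + (r + 1) = δ + 3 * r + 3 + w + δ + r + 1 by ring] at e2
    simp only [factorial_succ] at e2
    have e3 : ((δ + 2 * r)! * (δ + 3 * r + 3 + w + δ + r)! * w ! : ℤ) ≠ 0 := by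
      exact_mod_cast by positivity
    apply mul_right_cancel₀ e3
    zify at e2
    push_cast
    linear_combination e2

variable {k : Type*} [Field k]

lemma hasseCoeff_succ_cast {p : ℕ} [CharP k p] {q δ : ℕ} (hp : p = 4 * q + 2 * δ + 1)
    (hδ : δ = 0 ∨ δ = 1) (h2 : (2 : k) ≠ 0) (h3 : (3 : k) ≠ 0) (r : ℕ) :
    4 * ((r + 1) * (2 * r + 2 * δ + 1)) * (hasseCoeff q δ (r + 1) : k) =
      -27 * (2 * ((r + (6 * δ + 1) / 12) * (r + (6 * δ + 5) / 12))) * (hasseCoeff q δ r : k) := by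
  have h12 : (12 : k) ≠ 0 := by
    rw [show (12 : k) = 2 * 2 * 3 by norm_num]
    exact mul_ne_zero (mul_ne_zero h2 h2) h3
  by_cases hr : q < δ + 3 * r
  · rw [hasseCoeff_eq_zero hr, hasseCoeff_eq_zero (by omega)]; simp
  by_cases hr' : q ≤ r
  · have hr0 : r = 0 := by omega
    have hq : q = 0 := by omega
    have hδ0 : δ = 0 := by omega
    have := CharP.cast_eq_zero k p
    rw [hp, hq, hδ0] at this
    simp at this
  have hz : ((4 * r + 2 * δ + 3 : ℕ) : k) ≠ 0 := by
    rw [Ne, CharP.cast_eq_zero_iff k p]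
    intro h
    have := Nat.le_of_dvd (by omega) h
    omega
  push_cast at hz
  have hq : (4 * q + 2 * δ + 1 : k) = 0 := by
    have := CharP.cast_eq_zero k p
    rw [hp] at this
    exact_mod_cast this
  have hq' : (4 * q : k) = -(2 * δ + 1) := by linear_combination hq
  have h1 := congrArg (Int.cast : ℤ → k) (hasseCoeff_succ q δ r)
  push_cast at h1
  have hd : (δ + 2 * r + 1) * (δ + 2 * r + 2) = (2 * ((r + 1) * (2 * r + 2 * δ + 1)) : k) := by
    rcases hδ with rfl | rfl <;> push_cast <;> ring
  rw [hd] at h1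
  have e1 : 16 * (2 * ((r + 1) * (2 * r + 2 * δ + 1))) * (hasseCoeff q δ (r + 1) : k) =
      -3 * ((12 * r + 6 * δ + 1) * (12 * r + 6 * δ + 5)) * (hasseCoeff q δ r : k) := by
    apply mul_right_cancel₀ hz
    have l1 : (4 * r + 2 * δ + 3 : k) = 4 * (q + δ + r + 1) := by linear_combination -hq'
    have l2 : (12 * r + 6 * δ + 1 : k) = -4 * (q - δ - 3 * r) := by linear_combination hq'
    have l3 : (12 * r + 6 * δ + 5 : k) = -4 * (q - δ - 3 * r - 1) := by linear_combination hq'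
    have l4 : 3 * (4 * r + 2 * δ + 3 : k) = -4 * (q - δ - 3 * r - 2) := by linear_combination hq'
    calc _ = 16 * (2 * ((r + 1) * (2 * r + 2 * δ + 1))) * (hasseCoeff q δ (r + 1) : k) *
          (4 * (q + δ + r + 1)) := by rw [l1]
      _ = -((12 * r + 6 * δ + 1) * (12 * r + 6 * δ + 5)) * (hasseCoeff q δ r : k) *
          (3 * (4 * r + 2 * δ + 3)) := by
          rw [l2, l3, l4]
          linear_combination 64 * h1
      _ = _ := by ring
  have e2 : (r + (6 * δ + 1) / 12 : k) = (12 * r + 6 * δ + 1) / 12 := by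
    rw [eq_div_iff h12, add_mul, div_mul_cancel₀ _ h12]; ring
  have e3 : (r + (6 * δ + 5) / 12 : k) = (12 * r + 6 * δ + 5) / 12 := by
    rw [eq_div_iff h12, add_mul, div_mul_cancel₀ _ h12]; ring
  rw [e2, e3, div_mul_div_comm]
  apply mul_left_cancel₀ (pow_ne_zero 3 h2)
  have e4 : (2 : k) ^ 3 * (-27 * (2 * ((12 * r + 6 * δ + 1) * (12 * r + 6 * δ + 5) / (12 * 12)))) =
      -3 * ((12 * r + 6 * δ + 1) * (12 * r + 6 * δ + 5)) := by
    field_simp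
    ring
  linear_combination e1 - (hasseCoeff q δ r : k) * e4

lemma isHypergeometric_comp {a b : k} {d : ℕ → k} {G : k[X]} (hG : ∀ n, G.coeff n = d n)
    (hd : ∀ n : ℕ, (n + 1) * (n + (a + b)) * d (n + 1) = (n + a) * (n + b) * d n) :
    IsHypergeometric (a + b) (a * b) (G.comp (1 - X)) := by
  have h : X * (1 - X) * derivative (derivative G) +
      (C (a + b) - (C (a + b) + 1) * X) * derivative G - C (a * b) * G = 0 := by
    ext n
    have e : X * (1 - X) * derivative (derivative G) +
      (C (a + b) - (C (a + b) + 1) * X) * derivative G - C (a * b) * G =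
      X * derivative (derivative G) - X * (X * derivative (derivative G)) +
      C (a + b) * derivative G - C (a + b) * (X * derivative G) - X * derivative G -
        C (a * b) * G := by ring
    rw [e]
    have h1 := hd n
    rcases n with _ | _ | n
    · simp only [coeff_sub, coeff_add, coeff_C_mul, coeff_derivative, hG, coeff_X_mul_zero]
      push_cast at h1 ⊢
      simp only [coeff_zero]
      linear_combination h1
    · simp only [coeff_sub, coeff_add, coeff_C_mul, coeff_derivative, hG, coeff_X_mul,
        coeff_X_mul_zero, coeff_zero]
      push_cast at h1 ⊢
      linear_combination h1
    · simp only [coeff_sub, coeff_add, coeff_C_mul, coeff_derivative, hG, coeff_X_mul, coeff_zero]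
      push_cast at h1 ⊢
      linear_combination h1
  have h1 := congrArg (fun f : k[X] => f.comp (1 - X)) h
  simp only [sub_comp, add_comp, mul_comp, X_comp, one_comp, C_comp, zero_comp] at h1
  rw [IsHypergeometric, derivative_comp, derivative_mul, derivative_comp]
  simp only [derivative_sub, derivative_one, derivative_X, zero_sub, derivative_neg, neg_zero,
    zero_mul, zero_add]
  linear_combination h1

lemma IsHypergeometric.eval_zero_ne_zero {p : ℕ} [CharP k p] {α γ : k} {g : k[X]}
    (h : IsHypergeometric α γ g) (hg : g ≠ 0) (hp : g.natDegree < p) : g.eval 0 ≠ 0 := by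
  intro h0
  have hrec : ∀ n : ℕ, ((n + 1 : ℕ) : k) ^ 2 * g.coeff (n + 1) =
      (n ^ 2 + α * n + γ) * g.coeff n := by
    intro n
    have h1 := congrArg (fun f : k[X] => f.coeff n) h
    have e : X * (1 - X) * derivative (derivative g) + (1 - (C α + 1) * X) * derivative g - C γ * g =
      X * derivative (derivative g) - X * (X * derivative (derivative g)) +
      derivative g - C α * (X * derivative g) - X * derivative g - C γ * g := by ring
    simp only [e] at h1
    rcases n with _ | _ | n
    · simp only [coeff_sub, coeff_add, coeff_C_mul, coeff_derivative, coeff_X_mul_zero,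
        coeff_zero] at h1
      push_cast at h1 ⊢
      linear_combination h1
    · simp only [coeff_sub, coeff_add, coeff_C_mul, coeff_derivative, coeff_X_mul,
        coeff_X_mul_zero, coeff_zero] at h1
      push_cast at h1 ⊢
      linear_combination h1
    · simp only [coeff_sub, coeff_add, coeff_C_mul, coeff_derivative, coeff_X_mul,
        coeff_zero] at h1
      push_cast at h1 ⊢
      linear_combination h1
  apply hg
  ext n
  rw [coeff_zero]
  rcases lt_or_ge g.natDegree n with hn | hn
  · exact coeff_eq_zero_of_natDegree_lt hn
  induction n with
  | zero => rwa [coeff_zero_eq_eval_zero]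
  | succ n ih =>
    have h1 := hrec n
    rw [ih (by omega), mul_zero] at h1
    refine (mul_eq_zero.1 h1).resolve_left (pow_ne_zero _ ?_)
    rw [Ne, CharP.cast_eq_zero_iff k p]
    intro hd
    have := Nat.le_of_dvd (by omega) hd
    omega

end Hypergeometric

section Hasse

variable {p : ℕ} [Fact p.Prime]

lemma natCast_ne_zero_of_lt {n : ℕ} (h0 : n ≠ 0) (hn : n < p) : (n : ZMod p) ≠ 0 := by
  rw [Ne, CharP.cast_eq_zero_iff (ZMod p) p]
  intro h
  exact absurd (Nat.le_of_dvd (Nat.pos_of_ne_zero h0) h) (by omega)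

lemma natCast_ne_div_twelve (hp : 384 ≤ p) {δ : ℕ} (hδ : δ = 0 ∨ δ = 1) {e : ℕ}
    (he : 24 * (e + 1) ≤ p) :
    (e : ZMod p) ≠ (6 * δ + 1) / 12 ∧ (e : ZMod p) ≠ (6 * δ + 5) / 12 ∧
      (e : ZMod p) ≠ -((6 * δ + 1) / 12) ∧ (e : ZMod p) ≠ -((6 * δ + 5) / 12) := by
  have h12 : (12 : ZMod p) ≠ 0 := by
    exact_mod_cast natCast_ne_zero_of_lt (p := p) (n := 12) (by norm_num) (by omega)
  have key : ∀ z : ℤ, (z : ZMod p) = 0 → |z| < p → z = 0 := by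
    intro z hz hlt
    rw [ZMod.intCast_zmod_eq_zero_iff_dvd] at hz
    exact Int.eq_zero_of_abs_lt_dvd hz hlt
  refine ⟨fun h => ?_, fun h => ?_, fun h => ?_, fun h => ?_⟩
  · have := key (12 * e - (6 * δ + 1)) (by push_cast; rw [h]; field_simp; ring)
      (by rw [abs_lt]; omega)
    omega
  · have := key (12 * e - (6 * δ + 5)) (by push_cast; rw [h]; field_simp; ring)
      (by rw [abs_lt]; omega)
    omega
  · have := key (12 * e + (6 * δ + 1)) (by push_cast; rw [h]; field_simp; ring)
      (by rw [abs_lt]; omega)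
    omega
  · have := key (12 * e + (6 * δ + 5)) (by push_cast; rw [h]; field_simp; ring)
      (by rw [abs_lt]; omega)
    omega

lemma exists_small_finset_hasseCoeff (hp : 384 ≤ p) {q δ : ℕ} (hpq : p = 4 * q + 2 * δ + 1)
    (hδ : δ = 0 ∨ δ = 1) :
    ∃ W : Finset (ZMod p), W.card ^ 3 ≤ 6000 * p ^ 2 ∧
      ∀ x : ZMod p, x ≠ 0 →
        ∑ r ∈ Finset.range (q + 1), (hasseCoeff q δ r : ZMod p) * x ^ r = 0 → x ∈ W := by
  classical
  have h2 : (2 : ZMod p) ≠ 0 := by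
    exact_mod_cast natCast_ne_zero_of_lt (p := p) (n := 2) (by norm_num) (by omega)
  have h3 : (3 : ZMod p) ≠ 0 := by
    exact_mod_cast natCast_ne_zero_of_lt (p := p) (n := 3) (by norm_num) (by omega)
  have h4 : (4 : ZMod p) ≠ 0 := by
    exact_mod_cast natCast_ne_zero_of_lt (p := p) (n := 4) (by norm_num) (by omega)
  have h27 : (27 : ZMod p) ≠ 0 := by
    exact_mod_cast natCast_ne_zero_of_lt (p := p) (n := 27) (by norm_num) (by omega)
  have h12 : (12 : ZMod p) ≠ 0 := by
    exact_mod_cast natCast_ne_zero_of_lt (p := p) (n := 12) (by norm_num) (by omega)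
  set a : ZMod p := (6 * δ + 1) / 12 with ha
  set b : ZMod p := (6 * δ + 5) / 12 with hb
  have hab : a + b = (2 * δ + 1) / 2 := by
    rw [ha, hb]; field_simp; ring
  let d : ℕ → ZMod p := fun r => (hasseCoeff q δ r : ZMod p) * (-4 / 27) ^ r
  let G : (ZMod p)[X] := ∑ r ∈ Finset.range (q + 1), C (d r) * X ^ r
  have hG : ∀ n, G.coeff n = d n := by
    intro n
    simp only [G, finsetSum_coeff, coeff_C_mul_X_pow]
    rw [Finset.sum_ite_eq, ite_eq_left_iff]
    intro hn
    simp only [d]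
    rw [hasseCoeff_eq_zero (by simp at hn; omega), Nat.cast_zero, zero_mul]
  have hd : ∀ n : ℕ, (n + 1) * (n + (a + b)) * d (n + 1) = (n + a) * (n + b) * d n := by
    intro n
    have h := hasseCoeff_succ_cast (k := ZMod p) hpq hδ h2 h3 n
    rw [← ha, ← hb] at h
    simp only [d, pow_succ]
    rw [hab]
    generalize (-4 / 27 : ZMod p) ^ n = t
    generalize (hasseCoeff q δ (n + 1) : ZMod p) = u at *
    generalize (hasseCoeff q δ n : ZMod p) = v at *
    have e : (n + 1) * (n + (2 * δ + 1) / 2) * (u * (t * (-4 / 27))) =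
      (4 * ((n + 1) * (2 * n + 2 * δ + 1)) * u) * (t * (-1 / 27) / 2) := by
      field_simp; ring
    rw [e, h]
    field_simp
  have hode := isHypergeometric_comp hG hd
  have hd0 : d 0 ≠ 0 := by
    simp only [d, pow_zero, mul_one]
    have h := hasseCoeff_mul_factorial (q := q) (δ := δ) (r := 0) (by omega)
    intro h0
    rw [CharP.cast_eq_zero_iff (ZMod p) p] at h0
    have h1 := (h0.mul_right ((δ + 2 * 0).factorial * (q + δ + 0).factorial *
      (q - δ - 3 * 0).factorial))
    rw [h, (Fact.out : p.Prime).dvd_factorial] at h1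
    omega
  have hX : (1 - X : (ZMod p)[X]).natDegree = 1 := by
    rw [← natDegree_neg, neg_sub, ← C_1, natDegree_X_sub_C]
  have hg1 : (G.comp (1 - X)).eval 1 ≠ 0 := by
    rw [eval_comp]
    simpa [← coeff_zero_eq_eval_zero, hG] using hd0
  have hg0 : G.comp (1 - X) ≠ 0 := fun h => hg1 (by rw [h, eval_zero])
  have hdeg : (G.comp (1 - X)).natDegree < p := by
    rw [natDegree_comp, hX, mul_one]
    have : G.natDegree ≤ q := natDegree_sum_le_of_forall_le _ _ fun r hr =>
      (natDegree_C_mul_X_pow_le _ _).trans (Nat.lt_succ_iff.1 (Finset.mem_range.1 hr))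
    omega
  refine ⟨(Finset.univ.filter fun s => (G.comp (1 - X)).eval s = 0 ∧ s ≠ 1).image
    fun s => (s - 1) * 4 / 27, ?_, ?_⟩
  · refine (Nat.pow_le_pow_left Finset.card_image_le 3).trans ?_
    refine card_roots_pow_three_le (hode.eval_zero_ne_zero hg0 hdeg) hode hp hdeg.le
      (fun e he => natCast_ne_div_twelve hp hδ he) _ fun s hs => ?_
    rw [Finset.mem_filter] at hs
    exact ⟨hs.2.1, ZMod.pow_card s, hs.2.2⟩
  · intro x hx hsum
    refine Finset.mem_image.2 ⟨1 + 27 * x / 4, ?_, by field_simp; ring⟩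
    rw [Finset.mem_filter]
    refine ⟨Finset.mem_univ _, ?_, ?_⟩
    · rw [eval_comp, ← hsum]
      simp only [G, eval_finsetSum, eval_mul, eval_C, eval_pow, eval_X, eval_sub, eval_one, d]
      refine Finset.sum_congr rfl fun r _ => ?_
      rw [mul_assoc, ← mul_pow]
      congr 2
      field_simp
      ring
    · intro h
      have : 27 * x / 4 = 0 := by linear_combination h
      rw [div_eq_zero_iff, mul_eq_zero] at this
      tauto

lemma sum_pow_eq_ite {m e : ℕ} (hm : p = 2 * m + 1) (he : e ≤ 3 * m) :
    ∑ x : ZMod p, x ^ e = if e = 2 * m then -1 else 0 := by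
  have hm0 : m ≠ 0 := by
    rintro rfl
    exact (Fact.out : p.Prime).one_lt.ne' hm
  have hp1 : p - 1 = 2 * m := by omega
  split_ifs with h
  · rw [h, ← hp1]
    simp only [ZMod.pow_card_sub_one]
    rw [Finset.sum_ite, Finset.sum_const_zero, add_zero, Finset.sum_const, nsmul_one]
    have h1 : (Finset.univ.filter fun x : ZMod p => x ≠ 0).card = p - 1 := by
      rw [Finset.filter_ne' Finset.univ, Finset.card_erase_of_mem (Finset.mem_univ _),
        Finset.card_univ, ZMod.card]
    rw [h1, Nat.cast_sub (Fact.out : p.Prime).one_le]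
    simp
  · rcases lt_or_gt_of_ne h with h | h
    · apply FiniteField.sum_pow_lt_card_sub_one
      rw [ZMod.card]; omega
    · rw [← FiniteField.sum_pow_lt_card_sub_one (ZMod p) (e - 2 * m) (by rw [ZMod.card]; omega)]
      refine Finset.sum_congr rfl fun x _ => ?_
      by_cases hx : x = 0
      · rw [hx, zero_pow (by omega), zero_pow (by omega)]
      · conv_lhs => rw [← Nat.sub_add_cancel h.le, pow_add, ← hp1,
          ZMod.pow_card_sub_one_eq_one hx, mul_one, hp1]

lemma sum_linear_pow {m i : ℕ} (hm : p = 2 * m + 1) (hi : i ≤ m) (a b : ZMod p) :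
    ∑ x : ZMod p, (x ^ 3) ^ i * (a * x + b) ^ (m - i) =
      if 3 * i ≤ 2 * m ∧ m ≤ 2 * i then
        -(((m - i).choose (2 * m - 3 * i) : ZMod p) * a ^ (2 * m - 3 * i) * b ^ (2 * i - m))
      else 0 := by
  have h1 : ∀ x : ZMod p, (x ^ 3) ^ i * (a * x + b) ^ (m - i) =
      ∑ j ∈ Finset.range (m - i + 1),
        (((m - i).choose j : ZMod p) * a ^ j * b ^ (m - i - j)) * x ^ (3 * i + j) := by
    intro x
    rw [add_pow, Finset.mul_sum]
    refine Finset.sum_congr rfl fun j _ => ?_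
    rw [mul_pow, pow_add, pow_mul]
    ring
  simp only [h1]
  rw [Finset.sum_comm]
  simp only [← Finset.mul_sum]
  rw [Finset.sum_congr rfl fun j hj => by
    rw [sum_pow_eq_ite hm (by have := Finset.mem_range.1 hj; omega)]]
  split_ifs with h
  · rw [Finset.sum_eq_single (2 * m - 3 * i)]
    · rw [if_pos (by omega), show m - i - (2 * m - 3 * i) = 2 * i - m by omega, mul_neg, mul_one]
    · intro j _ hj
      rw [if_neg (by omega), mul_zero]
    · intro hj
      simp only [Finset.mem_range] at hj
      omega
  · refine Finset.sum_eq_zero fun j hj => ?_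
    rw [if_neg (by have := Finset.mem_range.1 hj; omega), mul_zero]

lemma sum_cubic_pow {q δ : ℕ} (hpq : p = 4 * q + 2 * δ + 1) (hδ : δ = 0 ∨ δ = 1) (a b : ZMod p) :
    ∑ x : ZMod p, (x ^ 3 + a * x + b) ^ (2 * q + δ) =
      -∑ r ∈ Finset.range (q + 1),
        (hasseCoeff q δ r : ZMod p) * (a ^ (q - δ - 3 * r) * b ^ (δ + 2 * r)) := by
  have h1 : ∀ x : ZMod p, (x ^ 3 + a * x + b) ^ (2 * q + δ) =
      ∑ i ∈ Finset.range (2 * q + δ + 1),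
        ((2 * q + δ).choose i : ZMod p) * ((x ^ 3) ^ i * (a * x + b) ^ (2 * q + δ - i)) := by
    intro x
    rw [add_assoc, add_pow]
    exact Finset.sum_congr rfl fun i _ => by ring
  simp only [h1]
  rw [Finset.sum_comm]
  simp only [← Finset.mul_sum]
  rw [Finset.sum_congr rfl fun i hi => by
    rw [sum_linear_pow (by omega) (Nat.lt_succ_iff.1 (Finset.mem_range.1 hi))]]
  rw [show 2 * q + δ + 1 = (q + δ) + (q + 1) by ring, Finset.sum_range_add,
    Finset.sum_eq_zero, zero_add, ← Finset.sum_neg_distrib]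
  · refine Finset.sum_congr rfl fun r hr => ?_
    by_cases hr' : q < δ + 3 * r
    · rw [hasseCoeff_eq_zero hr', if_neg (by omega)]; simp
    · rw [if_pos (by omega), hasseCoeff, show 2 * q + δ - (q + δ + r) = q - r by omega,
        show 2 * (2 * q + δ) - 3 * (q + δ + r) = q - δ - 3 * r by omega,
        show 2 * (q + δ + r) - (2 * q + δ) = δ + 2 * r by omega,
        Nat.choose_symm_of_eq_add (show q - r = (q - δ - 3 * r) + (δ + 2 * r) by omega)]
      push_cast
      ring
  · intro i hi
    have := Finset.mem_range.1 hi
    rw [if_neg (by omega), mul_zero]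

lemma hasse_sum_eq_zero {q δ : ℕ} (hpq : p = 4 * q + 2 * δ + 1) (hδ : δ = 0 ∨ δ = 1)
    {a b : ZMod p} (ha : a ≠ 0) (hb : b ≠ 0)
    (h : ∑ x : ZMod p, (x ^ 3 + a * x + b) ^ (2 * q + δ) = 0) :
    ∑ r ∈ Finset.range (q + 1), (hasseCoeff q δ r : ZMod p) * (b ^ 2 / a ^ 3) ^ r = 0 := by
  rw [sum_cubic_pow hpq hδ, neg_eq_zero] at h
  apply mul_left_cancel₀ (mul_ne_zero (pow_ne_zero (q - δ) ha) (pow_ne_zero δ hb))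
  rw [mul_zero, ← h, Finset.mul_sum]
  refine Finset.sum_congr rfl fun r _ => ?_
  by_cases hr' : q < δ + 3 * r
  · rw [hasseCoeff_eq_zero hr']; simp
  · rw [show q - δ = (q - δ - 3 * r) + 3 * r by omega, pow_add a, pow_add b, pow_mul a, pow_mul b,
      div_pow, show q - δ - 3 * r + 3 * r - 3 * r = q - δ - 3 * r by omega]
    have := pow_ne_zero r (pow_ne_zero 3 ha)
    field_simp

lemma sum_cubic_pow_eq_zero {m : ℕ} (hm : p = 2 * m + 1) {a b : ZMod p}
    (h : affinePoints p a b = p) : ∑ x : ZMod p, (x ^ 3 + a * x + b) ^ m = 0 := by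
  classical
  have hp2 : ringChar (ZMod p) ≠ 2 := by
    rw [ZMod.ringChar_zmod_n]; omega
  have h1 : affinePoints p a b =
      ∑ x : ZMod p, ({y : ZMod p | y ^ 2 = x ^ 3 + a * x + b} : Set (ZMod p)).toFinset.card := by
    rw [affinePoints, ← Finset.card_sigma]
    refine Finset.card_bij (fun xy _ => ⟨(xy.1 : ZMod p), (xy.2 : ZMod p)⟩) ?_ ?_ ?_
    · intro xy hxy
      simpa using (Finset.mem_filter.1 hxy).2
    · intro xy hxy zw hzw heq
      simp only [Finset.mem_filter, Finset.mem_product, Finset.mem_range] at hxy hzw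
      simp only [Sigma.mk.injEq, heq_eq_eq] at heq
      have h3 := (ZMod.natCast_eq_natCast_iff' _ _ _).1 heq.1
      have h4 := (ZMod.natCast_eq_natCast_iff' _ _ _).1 heq.2
      rw [Nat.mod_eq_of_lt hxy.1.1, Nat.mod_eq_of_lt hzw.1.1] at h3
      rw [Nat.mod_eq_of_lt hxy.1.2, Nat.mod_eq_of_lt hzw.1.2] at h4
      exact Prod.ext h3 h4
    · rintro ⟨x, y⟩ hxy
      refine ⟨(x.val, y.val), ?_, by simp⟩
      simp only [Finset.mem_filter, Finset.mem_product, Finset.mem_range, ZMod.val_lt,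
        ZMod.natCast_val, ZMod.cast_id', id, and_self, true_and]
      simpa using hxy
  have h2 : ((affinePoints p a b : ℤ) : ZMod p) =
      ∑ x : ZMod p, ((x ^ 3 + a * x + b) ^ m + 1) := by
    rw [h1]
    push_cast
    refine Finset.sum_congr rfl fun x _ => ?_
    have h3 := quadraticChar_card_sqrts hp2 (x ^ 3 + a * x + b)
    have h4 := congrArg (Int.cast : ℤ → ZMod p) h3
    push_cast at h4
    rw [h4, quadraticChar_eq_pow_of_char_ne_two' hp2, ZMod.card,
      show p / 2 = m by omega]
  rw [h, Finset.sum_add_distrib] at h2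
  simpa using h2.symm

/-- For a large prime `p`, the curves `y² = x³ + ax + b` with `ab ≠ 0` and trace zero over `𝔽_p`
take `O(p ^ (2/3))` values of `b² / a³`. -/
theorem exists_small_finset (hp : 384 ≤ p) :
    ∃ W : Finset (ZMod p), W.card ^ 3 ≤ 6000 * p ^ 2 ∧
      ∀ a b : ZMod p, a ≠ 0 → b ≠ 0 → affinePoints p a b = p → b ^ 2 / a ^ 3 ∈ W := by
  have hodd : p % 2 = 1 := (Fact.out : p.Prime).eq_two_or_odd.resolve_left (by omega)
  obtain ⟨q, δ, hδ, hpq⟩ : ∃ q δ, (δ = 0 ∨ δ = 1) ∧ p = 4 * q + 2 * δ + 1 :=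
    ⟨p / 4, (p / 2) % 2, by omega, by omega⟩
  obtain ⟨W, hW, hx⟩ := exists_small_finset_hasseCoeff hp hpq hδ
  refine ⟨W, hW, fun a b ha hb h => hx _ ?_ ?_⟩
  · exact div_ne_zero (pow_ne_zero _ hb) (pow_ne_zero _ ha)
  · exact hasse_sum_eq_zero hpq hδ ha hb (sum_cubic_pow_eq_zero (by omega) h)

end Hasse

section Counting

lemma eq_of_coprime_of_mul_eq {a b a' b' : ℕ} (h : a.Coprime b) (h' : a'.Coprime b')
    (he : a * b' = a' * b) : a = a' ∧ b = b' := by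
  constructor
  · exact Nat.dvd_antisymm (h.dvd_of_dvd_mul_right (he ▸ dvd_mul_right _ _))
      (h'.dvd_of_dvd_mul_right (he.symm ▸ dvd_mul_right _ _))
  · exact Nat.dvd_antisymm
      (h.symm.dvd_of_dvd_mul_left (he.symm ▸ dvd_mul_left _ _))
      (h'.symm.dvd_of_dvd_mul_left (he ▸ dvd_mul_left _ _))

lemma div_ne_div_of_add_le {n p a b a' b' : ℕ} (hp : 0 < p) (hb : 0 < b) (hb' : 0 < b')
    (hbn : b ≤ n) (hbn' : b' ≤ n) (h : a * b' + p ≤ a' * b) :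
    a * n ^ 2 / (b * p) ≠ a' * n ^ 2 / (b' * p) := by
  intro he
  have h1 := Nat.div_mul_le_self (a * n ^ 2) (b * p)
  have h2 := Nat.lt_mul_div_succ (a' * n ^ 2) (Nat.mul_pos hb' hp)
  rw [← he] at h2
  set m := a * n ^ 2 / (b * p)
  have h3 : b * b' ≤ n ^ 2 := by rw [sq]; exact Nat.mul_le_mul hbn hbn'
  have h4 : (a * b' + p) * n ^ 2 ≤ a' * b * n ^ 2 := Nat.mul_le_mul_right _ h
  have h5 : m * (b * p) * b' ≤ a * n ^ 2 * b' := Nat.mul_le_mul_right _ h1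
  have h6 : a' * n ^ 2 * b < b' * p * (m + 1) * b := Nat.mul_lt_mul_of_pos_right h2 hb
  have h7 : p * (b * b') ≤ p * n ^ 2 := Nat.mul_le_mul_left _ h3
  nlinarith

lemma card_le_of_pairwise_dvd {n p : ℕ} (hp : 0 < p) (S : Finset (ℕ × ℕ))
    (hS : ∀ x ∈ S, x.1.Coprime x.2 ∧ 0 < x.2 ∧ x.1 ≤ x.2 ∧ x.2 ≤ n)
    (hd : ∀ x ∈ S, ∀ y ∈ S, (p : ℤ) ∣ x.1 * y.2 - y.1 * x.2) : S.card ≤ n ^ 2 / p + 1 := by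
  have hle : ∀ x ∈ S, ∀ y ∈ S, x.1 * y.2 < y.1 * x.2 → x.1 * y.2 + p ≤ y.1 * x.2 := by
    intro x hx y hy hlt
    have h1 := Int.le_of_dvd (by zify at hlt; linarith) (hd y hy x hx)
    zify
    linarith
  rw [← Finset.card_range (n ^ 2 / p + 1)]
  refine Finset.card_le_card_of_injOn (fun x => x.1 * n ^ 2 / (x.2 * p)) ?_ ?_
  · intro x hx
    obtain ⟨-, h1, h2, -⟩ := hS x hx
    simp only [Finset.coe_range, Set.mem_Iio, Nat.lt_succ_iff]
    rw [← Nat.mul_div_mul_left (n ^ 2) p h1]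
    exact Nat.div_le_div_right (Nat.mul_le_mul_right _ h2)
  · intro x hx y hy hxy
    obtain ⟨hx0, hx1, -, hx3⟩ := hS x hx
    obtain ⟨hy0, hy1, -, hy3⟩ := hS y hy
    rcases lt_trichotomy (x.1 * y.2) (y.1 * x.2) with h | h | h
    · exact absurd hxy (div_ne_div_of_add_le hp hx1 hy1 hx3 hy3 (hle x hx y hy h))
    · obtain ⟨h1, h2⟩ := eq_of_coprime_of_mul_eq hx0 hy0 h
      exact Prod.ext h1 h2
    · exact absurd hxy.symm (div_ne_div_of_add_le hp hy1 hx1 hy3 hx3 (hle y hy x hx h))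

lemma card_coprime_le_of_pairwise_dvd {n p : ℕ} (hp : 0 < p) (S : Finset (ℕ × ℕ))
    (hS : ∀ x ∈ S, x.1.Coprime x.2 ∧ 0 < x.1 ∧ 0 < x.2 ∧ x.1 ≤ n ∧ x.2 ≤ n)
    (hd : ∀ x ∈ S, ∀ y ∈ S, (p : ℤ) ∣ x.1 * y.2 - y.1 * x.2) :
    S.card ≤ 2 * (n ^ 2 / p + 1) := by
  classical
  rw [← Finset.card_filter_add_card_filter_not (fun x : ℕ × ℕ => x.1 ≤ x.2), two_mul]
  refine add_le_add ?_ ?_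
  · refine card_le_of_pairwise_dvd hp _ (fun x hx => ?_) fun x hx y hy => ?_
    · rw [Finset.mem_filter] at hx
      obtain ⟨h1, -, h3, -, h5⟩ := hS x hx.1
      exact ⟨h1, h3, hx.2, h5⟩
    · exact hd x (Finset.mem_filter.1 hx).1 y (Finset.mem_filter.1 hy).1
  · rw [← Finset.card_image_of_injective _ Prod.swap_injective]
    refine card_le_of_pairwise_dvd hp _ (fun x hx => ?_) fun x hx y hy => ?_
    · obtain ⟨z, hz, rfl⟩ := Finset.mem_image.1 hx
      rw [Finset.mem_filter] at hz
      obtain ⟨h1, h2, -, h4, -⟩ := hS z hz.1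
      exact ⟨h1.symm, h2, (not_le.1 hz.2).le, h4⟩
    · obtain ⟨z, hz, rfl⟩ := Finset.mem_image.1 hx
      obtain ⟨w, hw, rfl⟩ := Finset.mem_image.1 hy
      have := hd w (Finset.mem_filter.1 hw).1 z (Finset.mem_filter.1 hz).1
      simp only [Prod.fst_swap, Prod.snd_swap]
      convert this using 1
      ring

lemma sum_inv_sq_le {n : ℕ} (hn : 2 ≤ n) :
    ∑ d ∈ Finset.Icc 2 n, (1 : ℝ) / (d : ℝ) ^ 2 ≤ 3 / 4 - 1 / n := by
  induction n, hn using Nat.le_induction with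
  | base => norm_num
  | succ n hn ih =>
    rw [Finset.sum_Icc_succ_top (by omega)]
    have hn0 : (0 : ℝ) < n := by positivity
    have h1 : (1 : ℝ) / ((n + 1 : ℕ) : ℝ) ^ 2 ≤ 1 / n - 1 / ((n + 1 : ℕ) : ℝ) := by
      push_cast
      rw [div_sub_div _ _ hn0.ne' (by positivity), div_le_div_iff₀ (by positivity) (by positivity)]
      nlinarith
    linarith

lemma card_fareyPairs_ge (T : ℝ) : (⌊T⌋₊ : ℝ) ^ 2 / 4 ≤ (fareyPairs T).card := by
  classical
  rw [fareyPairs]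
  set n := ⌊T⌋₊
  set P := Finset.Icc 1 n ×ˢ Finset.Icc 1 n with hP
  have hPc : P.card = n ^ 2 := by
    rw [hP, Finset.card_product, Nat.card_Icc, Nat.add_sub_cancel, sq]
  have h1 := Finset.card_filter_add_card_filter_not (s := P) (fun ab => Nat.Coprime ab.1 ab.2)
  have h2 : ((P.filter fun ab => ¬ Nat.Coprime ab.1 ab.2).card : ℝ) ≤ 3 / 4 * (n : ℝ) ^ 2 := by
    have hsub : (P.filter fun ab => ¬ Nat.Coprime ab.1 ab.2) ⊆
        (Finset.Icc 2 n).biUnion fun d =>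
          ((Finset.Icc 1 (n / d)) ×ˢ (Finset.Icc 1 (n / d))).image fun x => (d * x.1, d * x.2) := by
      rintro ⟨a, b⟩ hab
      simp only [hP, Finset.mem_filter, Finset.mem_product, Finset.mem_Icc] at hab
      obtain ⟨⟨⟨ha1, ha2⟩, hb1, hb2⟩, hc⟩ := hab
      have hg0 : 0 < a.gcd b := Nat.gcd_pos_of_pos_left _ ha1
      have hg1 : a.gcd b ≠ 1 := hc
      have hga : a.gcd b ≤ a := Nat.le_of_dvd ha1 (Nat.gcd_dvd_left _ _)
      have hgb : a.gcd b ≤ b := Nat.le_of_dvd hb1 (Nat.gcd_dvd_right _ _)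
      refine Finset.mem_biUnion.2 ⟨a.gcd b, Finset.mem_Icc.2 ⟨by omega, by omega⟩, ?_⟩
      refine Finset.mem_image.2 ⟨(a / a.gcd b, b / a.gcd b), ?_, ?_⟩
      · simp only [Finset.mem_product, Finset.mem_Icc]
        exact ⟨⟨Nat.div_pos hga hg0, Nat.div_le_div_right ha2⟩,
          Nat.div_pos hgb hg0, Nat.div_le_div_right hb2⟩
      · rw [Nat.mul_div_cancel' (Nat.gcd_dvd_left _ _), Nat.mul_div_cancel' (Nat.gcd_dvd_right _ _)]
    have h3 : (P.filter fun ab => ¬ Nat.Coprime ab.1 ab.2).card ≤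
        ∑ d ∈ Finset.Icc 2 n, (n / d) ^ 2 := by
      refine (Finset.card_le_card hsub).trans (Finset.card_biUnion_le.trans ?_)
      refine Finset.sum_le_sum fun d _ => Finset.card_image_le.trans ?_
      rw [Finset.card_product, Nat.card_Icc, Nat.add_sub_cancel, sq]
    have h4 : ((∑ d ∈ Finset.Icc 2 n, (n / d) ^ 2 : ℕ) : ℝ) ≤
        (n : ℝ) ^ 2 * ∑ d ∈ Finset.Icc 2 n, (1 : ℝ) / (d : ℝ) ^ 2 := by
      push_cast
      rw [Finset.mul_sum]
      refine Finset.sum_le_sum fun d _ => ?_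
      rw [mul_one_div, ← div_pow]
      exact pow_le_pow_left₀ (by positivity) Nat.cast_div_le 2
    refine (Nat.cast_le.2 h3).trans (h4.trans ?_)
    rw [mul_comm]
    refine mul_le_mul_of_nonneg_right ?_ (by positivity)
    rcases lt_or_ge n 2 with hn | hn
    · rw [Finset.Icc_eq_empty (by omega)]; norm_num
    · exact (sum_inv_sq_le hn).trans (by have : (0 : ℝ) ≤ 1 / n := by positivity
                                         linarith)
  rw [hPc] at h1
  have h5 := congrArg (Nat.cast : ℕ → ℝ) h1
  push_cast at h5
  linarith

lemma sum_rpow_neg_third_le (X : ℕ) :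
    ∑ m ∈ Finset.range (X + 1), (m : ℝ) ^ (2 / 3 : ℝ) / m ≤ 3 / 2 * (X : ℝ) ^ (2 / 3 : ℝ) := by
  induction X with
  | zero => simp
  | succ X ih =>
    rw [Finset.sum_range_succ]
    have hcube : ∀ n : ℕ, ((n : ℝ) ^ (1 / 3 : ℝ)) ^ 3 = n := fun n => by
      rw [← Real.rpow_natCast, ← Real.rpow_mul (by positivity)]; norm_num
    have hsq : ∀ n : ℕ, (n : ℝ) ^ (2 / 3 : ℝ) = ((n : ℝ) ^ (1 / 3 : ℝ)) ^ 2 := fun n => by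
      rw [← Real.rpow_natCast, ← Real.rpow_mul (by positivity)]; norm_num
    rw [hsq] at ih ⊢
    have hv3 := hcube X
    have hu3 := hcube (X + 1)
    have hv0 : 0 ≤ (X : ℝ) ^ (1 / 3 : ℝ) := by positivity
    have hu0 : 0 < ((X + 1 : ℕ) : ℝ) ^ (1 / 3 : ℝ) := by positivity
    have huv : (X : ℝ) ^ (1 / 3 : ℝ) ≤ ((X + 1 : ℕ) : ℝ) ^ (1 / 3 : ℝ) :=
      Real.rpow_le_rpow (by positivity) (by push_cast; linarith) (by norm_num)
    set u := ((X + 1 : ℕ) : ℝ) ^ (1 / 3 : ℝ)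
    set v := (X : ℝ) ^ (1 / 3 : ℝ)
    have h1 : u ^ 2 / ((X + 1 : ℕ) : ℝ) ≤ 3 / 2 * (u ^ 2 - v ^ 2) := by
      rw [← hu3, div_le_iff₀ (by positivity)]
      have h2 : u ^ 3 - v ^ 3 = 1 := by rw [hu3, hv3]; push_cast; ring
      have h3 : 0 ≤ (u - v) * u ^ 2 * (u - v) * (u + 2 * v) := by
        have := sub_nonneg.2 huv
        positivity
      have h4 : u ^ 2 = u ^ 2 * (u ^ 3 - v ^ 3) := by rw [h2, mul_one]
      rw [h4]
      nlinarith
    calc _ ≤ 3 / 2 * v ^ 2 + 3 / 2 * (u ^ 2 - v ^ 2) := add_le_add ih h1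
      _ = _ := by ring

end Counting

section Reduction

lemma exists_minor_ne_zero {A B : ℤ[X]} (hΔ : 4 * A ^ 3 + 27 * B ^ 2 ≠ 0)
    (hj : jNonconstant A B) :
    A ≠ 0 ∧ B ≠ 0 ∧ ∃ i j, (A ^ 3).coeff i * (B ^ 2).coeff j ≠ (A ^ 3).coeff j * (B ^ 2).coeff i := by
  have hA : A ≠ 0 := by
    rintro rfl
    exact hj 0 (by simp)
  have hmin : ∃ i j, (A ^ 3).coeff i * (B ^ 2).coeff j ≠
      (A ^ 3).coeff j * (B ^ 2).coeff i := by
    by_contra! h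
    set u := (A ^ 3).leadingCoeff with hu
    set v := (B ^ 2).coeff (A ^ 3).natDegree with hv
    have hu0 : u ≠ 0 := leadingCoeff_ne_zero.2 (pow_ne_zero 3 hA)
    have hprop : C u * B ^ 2 = C v * A ^ 3 := by
      ext j
      rw [coeff_C_mul, coeff_C_mul]
      exact (h (A ^ 3).natDegree j).trans (mul_comm _ _)
    have hw : 4 * u + 27 * v ≠ 0 := by
      intro h0
      have h1 : C u * (4 * A ^ 3 + 27 * B ^ 2) = C (4 * u + 27 * v) * A ^ 3 := by
        simp only [C_add, C_mul, map_ofNat]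
        linear_combination 27 * hprop
      rw [h0, C_0, zero_mul] at h1
      exact mul_ne_zero (C_ne_zero.2 hu0) hΔ h1
    have hpropQ : C (u : ℚ) * (B.map (Int.castRingHom ℚ)) ^ 2 =
        C (v : ℚ) * (A.map (Int.castRingHom ℚ)) ^ 3 := by
      have := congrArg (Polynomial.map (Int.castRingHom ℚ)) hprop
      simpa using this
    have hwQ : (4 * u + 27 * v : ℚ) ≠ 0 := by exact_mod_cast hw
    refine hj (-6912 * u / (4 * u + 27 * v)) ?_
    have h2 : C (4 * u + 27 * v : ℚ) ≠ 0 := C_ne_zero.2 hwQ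
    apply mul_left_cancel₀ h2
    rw [← mul_assoc (C _) (C _), ← C_mul, mul_div_cancel₀ _ hwQ]
    simp only [C_add, C_mul, C_neg, map_ofNat]
    linear_combination 6912 * 27 * hpropQ
  refine ⟨hA, ?_, hmin⟩
  rintro rfl
  obtain ⟨i, j, hij⟩ := hmin
  simp at hij

lemma eval₂_div_mul_pow {K : Type*} [Field K] (P : ℤ[X]) (α β : ℕ) (hβ : (β : K) ≠ 0) :
    P.eval₂ (Int.castRingHom K) (α / β) * (β : K) ^ P.natDegree =
      ((∑ i ∈ Finset.range (P.natDegree + 1),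
        P.coeff i * (α : ℤ) ^ i * (β : ℤ) ^ (P.natDegree - i) : ℤ) : K) := by
  rw [eval₂_eq_sum_range, Finset.sum_mul]
  push_cast
  refine Finset.sum_congr rfl fun i hi => ?_
  have hi : i ≤ P.natDegree := by simpa [Nat.lt_succ_iff] using hi
  rw [div_pow, eq_intCast]
  field_simp
  rw [mul_assoc (_ * _), ← pow_add, Nat.add_sub_cancel' hi]

lemma ratRed_eq {p : ℕ} [Fact p.Prime] {q : ℚ} {m : ℤ} {d : ℕ} (hd : (d : ZMod p) ≠ 0)
    (h : q * d = m) : ratRed p q = m / d := by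
  have h1 : q.num * d = m * q.den := by
    have h2 : (q.num : ℚ) * d = m * q.den := by
      rw [← h, mul_right_comm, Rat.mul_den_eq_num]
    exact_mod_cast h2
  have h3 : q.den ∣ d := by
    have h4 : (q.den : ℤ) ∣ q.num * d := h1 ▸ Dvd.intro_left _ rfl
    have h5 : IsCoprime (q.den : ℤ) q.num := by
      rw [Int.isCoprime_iff_nat_coprime]
      simpa using q.reduced.symm
    exact_mod_cast h5.dvd_of_dvd_mul_left h4
  have h6 : (q.den : ZMod p) ≠ 0 := by
    obtain ⟨e, he⟩ := h3
    rw [he, Nat.cast_mul] at hd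
    exact left_ne_zero_of_mul hd
  have h7 := congrArg (Int.cast : ℤ → ZMod p) h1
  push_cast at h7
  rw [ratRed, ← div_eq_mul_inv, div_eq_div_iff h6 hd, h7]

lemma ratRed_evalQ {p : ℕ} [Fact p.Prime] (P : ℤ[X]) (ab : ℕ × ℕ) (hb : (ab.2 : ZMod p) ≠ 0) :
    ratRed p (evalQ P (fareyFrac ab)) =
      (P.map (Int.castRingHom (ZMod p))).eval ((ab.1 : ZMod p) / ab.2) := by
  have hb0 : (ab.2 : ℚ) ≠ 0 := by
    intro h
    rw [Nat.cast_eq_zero] at h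
    simp [h] at hb
  have h1 := eval₂_div_mul_pow P ab.1 ab.2 hb0
  have h2 := eval₂_div_mul_pow P ab.1 ab.2 hb
  have h3 := ratRed_eq (p := p) (q := evalQ P (fareyFrac ab)) (d := ab.2 ^ P.natDegree)
    (by rw [Nat.cast_pow]; exact pow_ne_zero _ hb) (by rw [Nat.cast_pow]; exact h1)
  rw [h3, eval_map, ← h2, Nat.cast_pow, mul_div_cancel_right₀ _ (pow_ne_zero _ hb)]

lemma cast_snd_ne_zero {p : ℕ} [Fact p.Prime] {P : ℤ[X]} {ab : ℕ × ℕ} (hab : ab.1.Coprime ab.2)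
    (hb : 0 < ab.2) (hP : (P.leadingCoeff : ZMod p) ≠ 0) (hn : P.natDegree ≠ 0)
    (hden : ¬ (p : ℤ) ∣ (evalQ P (fareyFrac ab)).den) : (ab.2 : ZMod p) ≠ 0 := by
  intro h0
  have hb0 : (ab.2 : ℚ) ≠ 0 := by positivity
  have h1 := eval₂_div_mul_pow P ab.1 ab.2 hb0
  set m := ∑ i ∈ Finset.range (P.natDegree + 1),
        P.coeff i * (ab.1 : ℤ) ^ i * (ab.2 : ℤ) ^ (P.natDegree - i) with hm
  have h2 : (evalQ P (fareyFrac ab)).num * (ab.2 : ℤ) ^ P.natDegree =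
      m * (evalQ P (fareyFrac ab)).den := by
    have h3 : ((evalQ P (fareyFrac ab)).num : ℚ) * (ab.2 : ℚ) ^ P.natDegree =
        m * (evalQ P (fareyFrac ab)).den := by
      rw [← h1, mul_right_comm]
      exact congrArg (· * _) (Rat.mul_den_eq_num _).symm
    exact_mod_cast h3
  have h4 := congrArg (Int.cast : ℤ → ZMod p) h2
  push_cast at h4
  rw [h0, zero_pow hn, mul_zero] at h4
  have h5 : ((evalQ P (fareyFrac ab)).den : ZMod p) ≠ 0 := by
    rw [← Int.cast_natCast, Ne, ZMod.intCast_zmod_eq_zero_iff_dvd]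
    exact hden
  have h6 : (m : ZMod p) = P.leadingCoeff * (ab.1 : ZMod p) ^ P.natDegree := by
    rw [hm, Finset.sum_range_succ, Nat.sub_self]
    push_cast
    rw [Finset.sum_eq_zero, zero_add, pow_zero, mul_one, leadingCoeff]
    intro i hi
    rw [h0, zero_pow (by have := Finset.mem_range.1 hi; omega), mul_zero]
  have h7 : (m : ZMod p) = 0 := by simpa [h5] using h4.symm
  rw [h6] at h7
  have h8 : (ab.1 : ZMod p) = 0 := by
    by_contra h
    exact mul_ne_zero hP (pow_ne_zero _ h) h7
  rw [ZMod.natCast_eq_zero_iff] at h0 h8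
  exact Nat.Prime.one_lt (Fact.out : p.Prime) |>.ne' (Nat.eq_one_of_dvd_coprimes hab h8 h0)

end Reduction

section OnePrime

variable {p : ℕ} [Fact p.Prime]

lemma card_exceptional_le {a b : (ZMod p)[X]} (ha : a ≠ 0) (hb : b ≠ 0)
    (hab : ∀ w, b ^ 2 - C w * a ^ 3 ≠ 0) (W : Finset (ZMod p)) {D : ℕ}
    (hD : 3 * a.natDegree + 2 * b.natDegree ≤ D) :
    ∃ S : Finset (ZMod p), S.card ≤ D * (W.card + 2) ∧
      ∀ t, (a.eval t = 0 ∨ b.eval t = 0 ∨ b.eval t ^ 2 / a.eval t ^ 3 ∈ W) → t ∈ S := by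
  classical
  refine ⟨a.roots.toFinset ∪ (b.roots.toFinset ∪
    W.biUnion fun w => (b ^ 2 - C w * a ^ 3).roots.toFinset), ?_, ?_⟩
  · have hroots : ∀ f : (ZMod p)[X], f.roots.toFinset.card ≤ f.natDegree := fun f =>
      (Multiset.toFinset_card_le _).trans f.card_roots'
    have hW : (W.biUnion fun w => (b ^ 2 - C w * a ^ 3).roots.toFinset).card ≤ W.card * D := by
      refine Finset.card_biUnion_le_card_mul _ _ _ fun w _ => (hroots _).trans ?_
      have h1 : (b ^ 2).natDegree ≤ D := natDegree_pow_le.trans (by omega)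
      have h2 : (C w * a ^ 3).natDegree ≤ D :=
        (natDegree_C_mul_le _ _).trans (natDegree_pow_le.trans (by omega))
      exact natDegree_sub_le_of_le h1 h2 |>.trans (by simp)
    have h1 := Finset.card_union_le a.roots.toFinset (b.roots.toFinset ∪
      W.biUnion fun w => (b ^ 2 - C w * a ^ 3).roots.toFinset)
    have h2 := Finset.card_union_le b.roots.toFinset
      (W.biUnion fun w => (b ^ 2 - C w * a ^ 3).roots.toFinset)
    have h3 := hroots a
    have h4 := hroots b
    nlinarith
  · intro t ht
    simp only [Finset.mem_union, Multiset.mem_toFinset, Finset.mem_biUnion, mem_roots ha,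
      mem_roots hb, mem_roots (hab _), IsRoot.def]
    by_cases h0 : a.eval t = 0
    · exact Or.inl h0
    · rcases ht with h | h | h
      · exact Or.inl h
      · exact Or.inr (Or.inl h)
      · refine Or.inr (Or.inr ⟨_, h, ?_⟩)
        simp [div_mul_cancel₀ _ (pow_ne_zero 3 h0)]

lemma card_le_of_forall_mem (S : Finset (ZMod p)) (F : Finset (ℕ × ℕ)) {n : ℕ}
    (hF : ∀ x ∈ F, x.1.Coprime x.2 ∧ 0 < x.1 ∧ 0 < x.2 ∧ x.1 ≤ n ∧ x.2 ≤ n)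
    (hF0 : ∀ x ∈ F, (x.2 : ZMod p) ≠ 0 ∧ (x.1 : ZMod p) / x.2 ∈ S) :
    F.card ≤ S.card * (2 * (n ^ 2 / p + 1)) := by
  classical
  rw [mul_comm]
  refine Finset.card_le_mul_card_image_of_maps_to (f := fun x : ℕ × ℕ => (x.1 : ZMod p) / x.2)
    (fun x hx => (hF0 x hx).2) _ fun t _ => ?_
  refine card_coprime_le_of_pairwise_dvd (Fact.out : p.Prime).pos _
    (fun x hx => hF x (Finset.mem_filter.1 hx).1) fun x hx y hy => ?_
  rw [Finset.mem_filter] at hx hy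
  rw [← ZMod.intCast_zmod_eq_zero_iff_dvd]
  have h := hx.2.trans hy.2.symm
  rw [div_eq_div_iff (hF0 x hx.1).1 (hF0 y hy.1).1] at h
  push_cast
  rw [h, sub_self]

lemma rpow_bound {c p : ℕ} (hp : 0 < p) (h : c ^ 3 ≤ 6000 * p ^ 2) :
    ((c + 2 : ℕ) : ℝ) ≤ 21 * (p : ℝ) ^ (2 / 3 : ℝ) := by
  have h1 : (1 : ℝ) ≤ (p : ℝ) ^ (2 / 3 : ℝ) :=
    Real.one_le_rpow (by exact_mod_cast hp) (by norm_num)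
  have h2 : (c : ℝ) ≤ 19 * (p : ℝ) ^ (2 / 3 : ℝ) := by
    refine le_of_pow_le_pow_left₀ (n := 3) (by norm_num) (by positivity) ?_
    have h3 : ((p : ℝ) ^ (2 / 3 : ℝ)) ^ 3 = (p : ℝ) ^ 2 := by
      rw [← Real.rpow_natCast, ← Real.rpow_mul (by positivity), ← Real.rpow_natCast]
      norm_num
    rw [mul_pow, h3]
    have h4 : (c : ℝ) ^ 3 ≤ 6000 * (p : ℝ) ^ 2 := by exact_mod_cast h
    nlinarith [sq_nonneg (p : ℝ)]
  push_cast
  linarith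

open Classical in
theorem exists_card_le {A B : ℤ[X]} (hΔ : 4 * A ^ 3 + 27 * B ^ 2 ≠ 0) (hj : jNonconstant A B) :
    ∃ p₀ D : ℕ, ∀ p : ℕ, p.Prime → p₀ ≤ p → ∀ T : ℝ,
      (((fareyPairs T).filter fun ab =>
        goodRed A B (fareyFrac ab) p ∧ apFrob A B (fareyFrac ab) p = 0).card : ℝ) ≤
      42 * D * (p : ℝ) ^ (2 / 3 : ℝ) * ((⌊T⌋₊ : ℝ) ^ 2 / p + 1) := by
  obtain ⟨hA, hB, i, j, hij⟩ := exists_minor_ne_zero hΔ hj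
  set M : ℤ := (A ^ 3).coeff i * (B ^ 2).coeff j - (A ^ 3).coeff j * (B ^ 2).coeff i with hM
  have hM0 : M ≠ 0 := sub_ne_zero.2 hij
  have hN : M * A.leadingCoeff * B.leadingCoeff ≠ 0 :=
    mul_ne_zero (mul_ne_zero hM0 (leadingCoeff_ne_zero.2 hA)) (leadingCoeff_ne_zero.2 hB)
  refine ⟨max 384 ((M * A.leadingCoeff * B.leadingCoeff).natAbs + 1),
    3 * A.natDegree + 2 * B.natDegree, fun p hp hp0 T => ?_⟩
  have := Fact.mk hp
  have hp384 : 384 ≤ p := (le_max_left _ _).trans hp0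
  have hNp : ((M * A.leadingCoeff * B.leadingCoeff : ℤ) : ZMod p) ≠ 0 := by
    rw [Ne, ZMod.intCast_zmod_eq_zero_iff_dvd]
    intro h
    have h1 := Nat.le_of_dvd (Int.natAbs_pos.2 hN) (Int.natCast_dvd.1 h)
    have h2 := (le_max_right _ _).trans hp0
    omega
  rw [Int.cast_mul, Int.cast_mul] at hNp
  have hBl := right_ne_zero_of_mul hNp
  have hAl := right_ne_zero_of_mul (left_ne_zero_of_mul hNp)
  have hMl := left_ne_zero_of_mul (left_ne_zero_of_mul hNp)
  set φ := Int.castRingHom (ZMod p) with hφ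
  have ha : A.map φ ≠ 0 := fun h => hAl <| by
    have h1 := congrArg (coeff · A.natDegree) h
    simp only [coeff_map, coeff_zero] at h1
    exact h1
  have hb : B.map φ ≠ 0 := fun h => hBl <| by
    have h1 := congrArg (coeff · B.natDegree) h
    simp only [coeff_map, coeff_zero] at h1
    exact h1
  have hab : ∀ w, (B.map φ) ^ 2 - C w * (A.map φ) ^ 3 ≠ 0 := by
    intro w hw
    have h1 : ∀ k, (((B ^ 2).coeff k : ℤ) : ZMod p) = w * ((A ^ 3).coeff k : ℤ) := by
      intro k
      have h2 := congrArg (fun P => coeff P k) (sub_eq_zero.1 hw)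
      simp only [← Polynomial.map_pow, coeff_C_mul, coeff_map] at h2
      exact h2
    apply hMl
    rw [hM]
    push_cast
    rw [h1, h1]
    ring
  obtain ⟨W, hWc, hW⟩ := exists_small_finset hp384
  obtain ⟨S, hSc, hS⟩ := card_exceptional_le (D := 3 * A.natDegree + 2 * B.natDegree) ha hb hab W
    (add_le_add (Nat.mul_le_mul_left 3 natDegree_map_le) (Nat.mul_le_mul_left 2 natDegree_map_le))
  have hdeg : A.natDegree ≠ 0 ∨ B.natDegree ≠ 0 := by
    by_contra! h
    rw [natDegree_eq_zero, natDegree_eq_zero] at h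
    obtain ⟨⟨u, rfl⟩, ⟨v, rfl⟩⟩ := h
    apply hij
    simp only [← C_pow, coeff_C]
    split_ifs <;> simp_all
  set F := (fareyPairs T).filter fun ab =>
        goodRed A B (fareyFrac ab) p ∧ apFrob A B (fareyFrac ab) p = 0 with hF
  have hF1 : ∀ x ∈ F, x.1.Coprime x.2 ∧ 0 < x.1 ∧ 0 < x.2 ∧ x.1 ≤ ⌊T⌋₊ ∧ x.2 ≤ ⌊T⌋₊ := by
    intro x hx
    have := (Finset.mem_filter.1 hx).1
    simp only [fareyPairs, Finset.mem_filter, Finset.mem_product, Finset.mem_Icc] at this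
    exact ⟨this.2, this.1.1.1, this.1.2.1, this.1.1.2, this.1.2.2⟩
  have hcard := card_le_of_forall_mem S F hF1 fun x hx => by
    obtain ⟨hcop, -, hpos, -, -⟩ := hF1 x hx
    obtain ⟨-, ⟨hgA, hgB, -⟩, htr⟩ := Finset.mem_filter.1 hx
    have hx2 : (x.2 : ZMod p) ≠ 0 := by
      rcases hdeg with h | h
      · exact cast_snd_ne_zero hcop hpos hAl h hgA
      · exact cast_snd_ne_zero hcop hpos hBl h hgB
    refine ⟨hx2, hS _ ?_⟩
    rw [apFrob, ratRed_evalQ A x hx2, ratRed_evalQ B x hx2, sub_eq_zero, ← hφ] at htr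
    by_cases h1 : (A.map φ).eval ((x.1 : ZMod p) / x.2) = 0
    · exact Or.inl h1
    by_cases h2 : (B.map φ).eval ((x.1 : ZMod p) / x.2) = 0
    · exact Or.inr (Or.inl h2)
    exact Or.inr (Or.inr (hW _ _ h1 h2 (by exact_mod_cast htr.symm)))
  have hr := rpow_bound hp.pos hWc
  have hcard2 : F.card ≤ (3 * A.natDegree + 2 * B.natDegree) * (W.card + 2) *
      (2 * (⌊T⌋₊ ^ 2 / p + 1)) := hcard.trans (Nat.mul_le_mul_right _ hSc)
  have hdiv : ((⌊T⌋₊ ^ 2 / p : ℕ) : ℝ) ≤ (⌊T⌋₊ : ℝ) ^ 2 / p := by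
    have := Nat.cast_div_le (α := ℝ) (m := ⌊T⌋₊ ^ 2) (n := p)
    simpa using this
  set D := 3 * A.natDegree + 2 * B.natDegree
  calc (F.card : ℝ) ≤ ((D * (W.card + 2) * (2 * (⌊T⌋₊ ^ 2 / p + 1)) : ℕ) : ℝ) := by
        exact_mod_cast hcard2
    _ = D * ((W.card + 2 : ℕ) : ℝ) * (2 * (((⌊T⌋₊ ^ 2 / p : ℕ) : ℝ) + 1)) := by
        push_cast; ring
    _ ≤ D * (21 * (p : ℝ) ^ (2 / 3 : ℝ)) * (2 * ((⌊T⌋₊ : ℝ) ^ 2 / p + 1)) := by gcongr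
    _ = _ := by ring

end OnePrime

end LangTrotter

/-- Averaged Lang–Trotter bound for `a = 0`: for `x ≥ 2` and `T ≥ x^{5/6+ε}`,
`(1/#F(T))·Σ_{τ ∈ F(T), Δ(τ) ≠ 0} Π_{E(τ)}(0, x) ≤ C·x^{2/3}`. -/
theorem avg_lang_trotter_trace_zero_normalized (A B : Polynomial ℤ)
    (hΔ : 4 * A ^ 3 + 27 * B ^ 2 ≠ 0) (hj : jNonconstant A B)
    (ε : ℝ) (hε : 0 < ε) :
    ∃ C : ℝ, 0 < C ∧ ∀ x T : ℝ, 2 ≤ x → x ^ ((5 : ℝ) / 6 + ε) ≤ T →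
      (1 / ((fareyPairs T).card : ℝ)) *
          ∑ ab ∈ fareyPairs T,
            (if discQ A B (fareyFrac ab) ≠ 0 then
              ((PiTrace A B (fareyFrac ab) 0 x : ℝ)) else 0) ≤
        C * x ^ ((2 : ℝ) / 3) := by
  classical
  obtain ⟨p₀, D, hbound⟩ := LangTrotter.exists_card_le hΔ hj
  refine ⟨p₀ + 168 * D * 5.5 + 1, by positivity, fun x T hx hT => ?_⟩
  have hx0 : 0 < x := by linarith
  have hT56 : x ^ (5 / 6 : ℝ) ≤ T :=
    (Real.rpow_le_rpow_of_exponent_le (by linarith) (by linarith)).trans hT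
  have hT1 : 1 ≤ T := (Real.one_le_rpow (by linarith) (by norm_num)).trans hT56
  set n := ⌊T⌋₊ with hn
  have hn1 : (1 : ℝ) ≤ n := by exact_mod_cast Nat.floor_pos.2 hT1
  have hnT : T ≤ 2 * n := by linarith [(Nat.lt_floor_add_one T).le]
  have hx53 : x * x ^ (2 / 3 : ℝ) ≤ 4 * (n : ℝ) ^ 2 := by
    have h1 : x * x ^ (2 / 3 : ℝ) = (x ^ (5 / 6 : ℝ)) ^ 2 := by
      rw [← Real.rpow_natCast, ← Real.rpow_mul hx0.le, ← Real.rpow_one_add' hx0.le (by norm_num)]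
      norm_num
    rw [h1]
    nlinarith [Real.rpow_pos_of_pos hx0 (5 / 6 : ℝ)]
  have hcard := LangTrotter.card_fareyPairs_ge T
  rw [← hn] at hcard
  have hF0 : (0 : ℝ) < (fareyPairs T).card := by
    have : (0 : ℝ) < (n : ℝ) ^ 2 / 4 := by positivity
    linarith
  have hx23 : 1 ≤ x ^ (2 / 3 : ℝ) := Real.one_le_rpow (by linarith) (by norm_num)
  have hfx : (⌊x⌋₊ : ℝ) ≤ x := Nat.floor_le hx0.le
  let hit : ℕ → ℕ := fun p => ((fareyPairs T).filter fun ab =>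
    p.Prime ∧ goodRed A B (fareyFrac ab) p ∧ apFrob A B (fareyFrac ab) p = 0).card
  have hsum : ∑ ab ∈ fareyPairs T, (if discQ A B (fareyFrac ab) ≠ 0 then
      ((PiTrace A B (fareyFrac ab) 0 x : ℝ)) else 0) ≤
      ∑ p ∈ Finset.range (⌊x⌋₊ + 1), (hit p : ℝ) := by
    calc _ ≤ ∑ ab ∈ fareyPairs T, (PiTrace A B (fareyFrac ab) 0 x : ℝ) := by
          refine Finset.sum_le_sum fun ab _ => ?_
          split_ifs
          · exact le_rfl
          · positivity
      _ = _ := by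
          simp only [PiTrace, hit, Finset.card_filter, Nat.cast_sum]
          rw [Finset.sum_comm]
  have hhit : ∀ p ∈ Finset.range (⌊x⌋₊ + 1), (hit p : ℝ) ≤
      (if p < p₀ then ((fareyPairs T).card : ℝ) else 0) +
      42 * D * ((n : ℝ) ^ 2 * ((p : ℝ) ^ (2 / 3 : ℝ) / p) + (p : ℝ) ^ (2 / 3 : ℝ)) := by
    intro p _
    by_cases hp0 : p < p₀
    · have h1 : (hit p : ℝ) ≤ (fareyPairs T).card := by
        exact_mod_cast Finset.card_filter_le _ _
      rw [if_pos hp0]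
      have : 0 ≤ 42 * D * ((n : ℝ) ^ 2 * ((p : ℝ) ^ (2 / 3 : ℝ) / p) + (p : ℝ) ^ (2 / 3 : ℝ)) := by
        positivity
      linarith
    · rw [if_neg hp0, zero_add]
      by_cases hp : p.Prime
      · have h1 := hbound p hp (not_lt.1 hp0) T
        simp only [hit, hp, true_and]
        refine h1.trans (le_of_eq ?_)
        rw [← hn]
        ring
      · simp only [hit, hp, false_and, Finset.filter_false, Finset.card_empty, Nat.cast_zero]
        positivity
  have hsmall : ∑ p ∈ Finset.range (⌊x⌋₊ + 1),
      (if p < p₀ then ((fareyPairs T).card : ℝ) else 0) ≤ p₀ * (fareyPairs T).card := by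
    rw [← Finset.sum_filter, Finset.sum_const, nsmul_eq_mul]
    gcongr
    calc _ ≤ (Finset.range p₀).card := Finset.card_le_card fun p hp => by
          simpa using (Finset.mem_filter.1 hp).2
      _ = p₀ := Finset.card_range _
  have hrec : ∑ p ∈ Finset.range (⌊x⌋₊ + 1), (p : ℝ) ^ (2 / 3 : ℝ) / p ≤
      3 / 2 * x ^ (2 / 3 : ℝ) :=
    (LangTrotter.sum_rpow_neg_third_le _).trans (by gcongr)
  have hpow : ∑ p ∈ Finset.range (⌊x⌋₊ + 1), (p : ℝ) ^ (2 / 3 : ℝ) ≤ 4 * (n : ℝ) ^ 2 := by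
    rw [Finset.sum_range_succ', Nat.cast_zero, Real.zero_rpow (by norm_num), add_zero]
    refine (Finset.sum_le_card_nsmul _ _ (x ^ (2 / 3 : ℝ)) fun p hp => ?_).trans ?_
    · have h1 : ((p + 1 : ℕ) : ℝ) ≤ ⌊x⌋₊ := by
        exact_mod_cast Finset.mem_range.1 hp
      exact Real.rpow_le_rpow (by positivity) (h1.trans hfx) (by norm_num)
    · rw [Finset.card_range, nsmul_eq_mul]
      exact (mul_le_mul_of_nonneg_right hfx (by positivity)).trans hx53
  rw [one_div_mul_eq_div, div_le_iff₀ hF0]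
  set F := ((fareyPairs T).card : ℝ)
  set y := x ^ (2 / 3 : ℝ)
  have hn4 : (n : ℝ) ^ 2 ≤ 4 * F := by linarith
  calc _ ≤ _ := hsum
    _ ≤ _ := Finset.sum_le_sum hhit
    _ ≤ p₀ * F + 42 * D * ((n : ℝ) ^ 2 * (3 / 2 * y) + 4 * (n : ℝ) ^ 2) := by
        rw [Finset.sum_add_distrib, ← Finset.mul_sum, Finset.sum_add_distrib, ← Finset.mul_sum]
        gcongr
    _ ≤ p₀ * F + 42 * D * (4 * F * (3 / 2 * y) + 4 * (4 * F)) := by gcongr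
    _ = (p₀ * 1 + 168 * D * (1.5 * y + 4 * 1)) * F := by ring
    _ ≤ (p₀ * y + 168 * D * (1.5 * y + 4 * y)) * F := by gcongr
    _ ≤ (p₀ * y + 168 * D * (1.5 * y + 4 * y) + y) * F :=
        mul_le_mul_of_nonneg_right (by linarith) hF0.le
    _ = _ := by ring
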